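/- Let α > 0 and 1 ≤ p < 4/3. The set Γ∖{γ_0} = {γ_n : n ≥ 1} is a complete interpolating sequence for F^p_φ if and only if the following three conditions hold: (a) Γ is d_ρ-separated; (b) the sequence (δ_n)_{n≥0} is bounded; (c) there exists an integer N ≥ 1 such that −(1/(4α) + 1/(qα)) < ∇_N ≤ Δ_N < 1/(4α) − 1/(qα). -/

import Mathlib

open MeasureTheory Complex
open scoped ENNReal

noncomputable section

/-- `log⁺ t = max (log t) 0`. -/
def logPlus (t : ℝ) : ℝ := max (Real.log t) 0

/-- The weight `φ(z) = α (log⁺ |z|)²`. -/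
def phi (α : ℝ) (z : ℂ) : ℝ := α * (logPlus ‖z‖) ^ 2

/-- `‖f‖_{p,φ}^p = ∫_ℂ |f(z) e^{-φ(z)}|^p dm(z)` as an extended nonnegative real. -/
def fockNormP (α p : ℝ) (f : ℂ → ℂ) : ℝ≥0∞ :=
  ∫⁻ z : ℂ, ENNReal.ofReal ((‖f z‖ * Real.exp (-(phi α z))) ^ p)

/-- Membership in the Fock space `F^p_φ`: entire and finite norm. -/
def MemFock (α p : ℝ) (f : ℂ → ℂ) : Prop :=
  Differentiable ℂ f ∧ fockNormP α p f < ⊤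

/-- The discrete norm `‖f‖_{p,φ,Λ}^p = Σ_{λ∈Λ} (1+|λ|)² |f(λ)|^p e^{-pφ(λ)}`. -/
def discNormP (α p : ℝ) (Λ : Set ℂ) (f : ℂ → ℂ) : ℝ≥0∞ :=
  ∑' lam : Λ, ENNReal.ofReal
    ((1 + ‖(lam : ℂ)‖) ^ 2 * ‖f (lam : ℂ)‖ ^ p *
      Real.exp (-(p * phi α (lam : ℂ))))

/-- `Λ` is sampling for `F^p_φ`. -/
def Sampling (α p : ℝ) (Λ : Set ℂ) : Prop :=
  ∃ C : ℝ, 1 ≤ C ∧ ∀ f : ℂ → ℂ, MemFock α p f →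
    (ENNReal.ofReal C)⁻¹ * fockNormP α p f ≤ discNormP α p Λ f ∧
    discNormP α p Λ f ≤ ENNReal.ofReal C * fockNormP α p f

/-- `Λ` is interpolating for `F^p_φ`. -/
def Interpolating (α p : ℝ) (Λ : Set ℂ) : Prop :=
  ∀ v : ℂ → ℂ,
    (∑' lam : Λ, ENNReal.ofReal
      ((1 + ‖(lam : ℂ)‖) ^ 2 * ‖v (lam : ℂ)‖ ^ p *
        Real.exp (-(p * phi α (lam : ℂ))))) < ⊤ →
    ∃ f : ℂ → ℂ, MemFock α p f ∧ ∀ lam ∈ Λ, f lam = v lam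

/-- `Λ` is a complete interpolating sequence for `F^p_φ`. -/
def CompleteInterpolating (α p : ℝ) (Λ : Set ℂ) : Prop :=
  Sampling α p Λ ∧ Interpolating α p Λ

/-- `ρ(z) = |z| / √(2α)`. -/
def rhoF (α : ℝ) (z : ℂ) : ℝ := ‖z‖ / Real.sqrt (2 * α)

/-- `d_ρ(z,w) = |z-w| / (1 + min(ρ(z), ρ(w)))`. -/
def dRho (α : ℝ) (z w : ℂ) : ℝ :=
  ‖z - w‖ / (1 + min (rhoF α z) (rhoF α w))

/-- `Λ` is `d_ρ`-separated. -/
def DRhoSeparated (α : ℝ) (Λ : Set ℂ) : Prop :=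
  ∃ ε : ℝ, 0 < ε ∧ ∀ l ∈ Λ, ∀ l' ∈ Λ, l ≠ l' → ε ≤ dRho α l l'

/-- The average `(1/N) Σ_{k=n}^{n+N-1} δ_k`. -/
def avgD (δ : ℕ → ℝ) (N n : ℕ) : ℝ := (1 / (N : ℝ)) * ∑ k ∈ Finset.range N, δ (n + k)


/-! ## Polar coordinates -/

lemma circle_shift (F : ℂ → ℝ≥0∞) (c : ℂ) (r : ℝ) :
    ∫⁻ θ in Set.Ioo (-Real.pi) Real.pi, F (circleMap c r θ) =
      ∫⁻ θ in Set.Ioc 0 (2 * Real.pi), F (circleMap c r θ) := by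
  have hpi := Real.two_pi_pos
  rw [Measure.restrict_congr_set (Ioo_ae_eq_Ioc (a := -Real.pi) (b := Real.pi))]
  have h1 := isAddFundamentalDomain_Ioc hpi (-Real.pi) volume
  have h2 := isAddFundamentalDomain_Ioc hpi 0 volume
  have h3 := h1.setLIntegral_eq h2 (fun θ => F (circleMap c r θ)) (by
    rintro ⟨g, hg⟩ x
    obtain ⟨n, rfl⟩ := AddSubgroup.mem_zmultiples_iff.1 hg
    have := (periodic_circleMap c r).int_mul n x
    show F (circleMap c r (n • (2 * Real.pi) + x)) = _
    rw [zsmul_eq_mul, add_comm, this])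
  rw [show -Real.pi + 2 * Real.pi = Real.pi by ring, zero_add] at h3
  exact h3

lemma polar_circ (F : ℂ → ℝ≥0∞) (hF : Measurable F) (c : ℂ) :
    ∫⁻ z, F z = ∫⁻ r in Set.Ioi (0 : ℝ), ENNReal.ofReal r *
      ∫⁻ θ in Set.Ioc 0 (2 * Real.pi), F (circleMap c r θ) := by
  rw [← lintegral_add_right_eq_self F c, ← Complex.lintegral_comp_polarCoord_symm]
  have e : ∀ q : ℝ × ℝ, Complex.polarCoord.symm q + c = circleMap c q.1 q.2 := by
    intro q
    rw [Complex.polarCoord_symm_apply, circleMap, Complex.exp_mul_I]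
    push_cast
    ring
  simp_rw [e]
  have hm : Measurable fun q : ℝ × ℝ => circleMap c q.1 q.2 := by
    unfold circleMap; fun_prop
  rw [show polarCoord.target = Set.Ioi (0 : ℝ) ×ˢ Set.Ioo (-Real.pi) Real.pi from rfl,
    Measure.volume_eq_prod, setLIntegral_prod _ (by
      apply Measurable.aemeasurable
      simp only [smul_eq_mul]
      exact (ENNReal.measurable_ofReal.comp measurable_fst).mul (hF.comp hm))]
  refine setLIntegral_congr_fun measurableSet_Ioi fun r _ => ?_
  simp only [smul_eq_mul]
  rw [lintegral_const_mul]
  · rw [circle_shift]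
  · exact hF.comp (hm.comp (measurable_const.prodMk measurable_id))

lemma lint_r (R : ℝ) (hR : 0 ≤ R) :
    ∫⁻ r in Set.Ioo (0 : ℝ) R, ENNReal.ofReal r = ENNReal.ofReal (R ^ 2 / 2) := by
  rw [Measure.restrict_congr_set (Ioo_ae_eq_Ioc (a := (0:ℝ)) (b := R)),
    ← ofReal_integral_eq_lintegral_ofReal]
  · rw [← intervalIntegral.integral_of_le hR]; simp
  · exact (continuous_id.integrableOn_Icc (a := 0) (b := R)).mono_set Set.Ioc_subset_Icc_self
  · filter_upwards [ae_restrict_mem measurableSet_Ioc] with x hx using hx.1.le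

lemma ball_polar (F : ℂ → ℝ≥0∞) (hF : Measurable F) (c : ℂ) (R : ℝ) :
    ∫⁻ z in Metric.ball c R, F z = ∫⁻ r in Set.Ioo (0 : ℝ) R, ENNReal.ofReal r *
      ∫⁻ θ in Set.Ioc 0 (2 * Real.pi), F (circleMap c r θ) := by
  rw [← lintegral_indicator measurableSet_ball, polar_circ _ (hF.indicator measurableSet_ball) c,
    ← lintegral_indicator measurableSet_Ioo, ← lintegral_indicator measurableSet_Ioi]
  congr 1
  ext r
  by_cases hr : 0 < r
  · by_cases hr' : r < R
    · rw [Set.indicator_of_mem (show r ∈ Set.Ioi 0 from hr),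
        Set.indicator_of_mem (show r ∈ Set.Ioo 0 R from ⟨hr, hr'⟩)]
      congr 2
      ext θ
      rw [Set.indicator_of_mem]
      rw [Metric.mem_ball, dist_eq_norm, circleMap_sub_center, norm_circleMap_zero, abs_of_pos hr]; exact hr'
    · rw [Set.indicator_of_mem (show r ∈ Set.Ioi 0 from hr),
        Set.indicator_of_notMem (fun h : r ∈ Set.Ioo 0 R => hr' h.2)]
      have : ∀ θ, (Metric.ball c R).indicator F (circleMap c r θ) = 0 := by
        intro θ
        rw [Set.indicator_of_notMem]
        rw [Metric.mem_ball, dist_eq_norm, circleMap_sub_center, norm_circleMap_zero, abs_of_pos hr]; exact hr'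
      simp [this]
  · rw [Set.indicator_of_notMem (fun h : r ∈ Set.Ioi 0 => hr h),
      Set.indicator_of_notMem (fun h : r ∈ Set.Ioo 0 R => hr h.1)]

lemma ball_lower (F : ℂ → ℝ≥0∞) (hF : Measurable F) (c : ℂ) (R : ℝ) (hR : 0 ≤ R) (m : ℝ≥0∞)
    (h : ∀ r ∈ Set.Ioo 0 R, m ≤ ∫⁻ θ in Set.Ioc 0 (2 * Real.pi), F (circleMap c r θ)) :
    ENNReal.ofReal (R ^ 2 / 2) * m ≤ ∫⁻ z in Metric.ball c R, F z := by
  rw [ball_polar F hF c R, ← lint_r R hR, ← lintegral_mul_const _ ENNReal.measurable_ofReal]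
  refine setLIntegral_mono' measurableSet_Ioo fun r hr => ?_
  gcongr
  exact h r hr

lemma ball_upper (F : ℂ → ℝ≥0∞) (hF : Measurable F) (c : ℂ) (R : ℝ) (hR : 0 ≤ R) (m : ℝ≥0∞)
    (h : ∀ r ∈ Set.Ioo 0 R, ∫⁻ θ in Set.Ioc 0 (2 * Real.pi), F (circleMap c r θ) ≤ m) :
    ∫⁻ z in Metric.ball c R, F z ≤ ENNReal.ofReal (R ^ 2 / 2) * m := by
  rw [ball_polar F hF c R, ← lint_r R hR, ← lintegral_mul_const _ ENNReal.measurable_ofReal]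
  refine setLIntegral_mono' measurableSet_Ioo fun r hr => ?_
  gcongr
  exact h r hr

/-- lower bound of a lintegral over a circle by a circle average -/
lemma circ_avg_le (u : ℂ → ℝ) (c : ℂ) (r : ℝ) (hu : CircleIntegrable u c r) :
    ENNReal.ofReal (2 * Real.pi * Real.circleAverage u c r) ≤
      ∫⁻ θ in Set.Ioc 0 (2 * Real.pi), ENNReal.ofReal (u (circleMap c r θ)) := by
  have hpi := Real.two_pi_pos
  rw [Real.circleAverage, smul_eq_mul, mul_inv_cancel_left₀ hpi.ne',
    intervalIntegral.integral_of_le hpi.le]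
  have hi : IntegrableOn (fun θ => u (circleMap c r θ)) (Set.Ioc 0 (2 * Real.pi)) :=
    (intervalIntegrable_iff_integrableOn_Ioc_of_le hpi.le).1 hu
  have h1 : ∫ θ in Set.Ioc 0 (2 * Real.pi), u (circleMap c r θ) ≤
      ∫ θ in Set.Ioc 0 (2 * Real.pi), max (u (circleMap c r θ)) 0 :=
    integral_mono hi (hi.pos_part) fun θ => le_max_left _ _
  refine (ENNReal.ofReal_le_ofReal h1).trans ?_
  rw [ofReal_integral_eq_lintegral_ofReal hi.pos_part (Filter.Eventually.of_forall fun θ => le_max_right _ _)]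
  refine lintegral_mono fun θ => ?_
  simp [ENNReal.ofReal_max]

lemma circ_avg_eq (u : ℂ → ℝ) (c : ℂ) (r : ℝ) (hu : CircleIntegrable u c r)
    (h0 : ∀ θ, 0 ≤ u (circleMap c r θ)) :
    ∫⁻ θ in Set.Ioc 0 (2 * Real.pi), ENNReal.ofReal (u (circleMap c r θ)) =
    ENNReal.ofReal (2 * Real.pi * Real.circleAverage u c r) := by
  have hpi := Real.two_pi_pos
  rw [Real.circleAverage, smul_eq_mul, mul_inv_cancel_left₀ hpi.ne',
    intervalIntegral.integral_of_le hpi.le]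
  have hi : IntegrableOn (fun θ => u (circleMap c r θ)) (Set.Ioc 0 (2 * Real.pi)) :=
    (intervalIntegrable_iff_integrableOn_Ioc_of_le hpi.le).1 hu
  rw [ofReal_integral_eq_lintegral_ofReal hi (Filter.Eventually.of_forall h0)]

lemma bernoulli_tangent {p x y : ℝ} (hp : 1 ≤ p) (hx : 0 ≤ x) (hy : 0 < y) :
    y ^ p + p * y ^ (p - 1) * (x - y) ≤ x ^ p := by
  have h := one_add_mul_self_le_rpow_one_add (s := x / y - 1) (by
    have : 0 ≤ x / y := by positivity
    linarith) hp
  rw [show 1 + (x / y - 1) = x / y by ring, Real.div_rpow hx hy.le,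
    le_div_iff₀ (by positivity)] at h
  have e : y ^ p = y ^ (p - 1) * y := by
    rw [← Real.rpow_add_one hy.ne']; ring_nf
  calc y ^ p + p * y ^ (p - 1) * (x - y) = (1 + p * (x / y - 1)) * y ^ p := by
        rw [e]; field_simp
    _ ≤ _ := h

lemma circ_lower {p : ℝ} (hp : 1 ≤ p) (h : ℂ → ℂ) (c : ℂ) (r : ℝ) (hr : 0 < r)
    (hd : DiffContOnCl ℂ h (Metric.ball c r)) :
    ENNReal.ofReal (2 * Real.pi * ‖h c‖ ^ p) ≤
      ∫⁻ θ in Set.Ioc 0 (2 * Real.pi), ENNReal.ofReal (‖h (circleMap c r θ)‖ ^ p) := by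
  rcases eq_or_ne (h c) 0 with h0 | h0
  · rw [h0]; simp [Real.zero_rpow (by linarith : p ≠ 0)]
  have hy : 0 < ‖h c‖ := norm_pos_iff.2 h0
  have hcont : ContinuousOn h (Metric.sphere c |r|) := by
    rw [abs_of_pos hr]
    exact hd.continuousOn_ball.mono Metric.sphere_subset_closedBall
  set u : ℂ → ℝ := fun z => ‖h c‖ ^ p + p * ‖h c‖ ^ (p - 1) * (‖h z‖ - ‖h c‖) with hu
  have hci : CircleIntegrable (fun z => ‖h z‖) c r := hcont.norm.circleIntegrable'
  have hcu : CircleIntegrable u c r := by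
    refine ContinuousOn.circleIntegrable' ?_
    exact continuousOn_const.add (continuousOn_const.mul (hcont.norm.sub continuousOn_const))
  have hmv : Real.circleAverage h c r = h c := by
    apply DiffContOnCl.circleAverage; rwa [abs_of_pos hr]
  have hle : ‖h c‖ ≤ Real.circleAverage (fun z => ‖h z‖) c r := by
    have hpi := Real.two_pi_pos
    rw [← hmv]
    simp only [Real.circleAverage, norm_smul, smul_eq_mul]
    rw [Real.norm_of_nonneg (by positivity)]
    gcongr
    exact intervalIntegral.norm_integral_le_integral_norm hpi.le
  have havg : Real.circleAverage u c r = ‖h c‖ ^ p + p * ‖h c‖ ^ (p - 1) *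
      (Real.circleAverage (fun z => ‖h z‖) c r - ‖h c‖) := by
    have hpi := Real.two_pi_pos
    simp only [Real.circleAverage, hu, smul_eq_mul]
    rw [intervalIntegral.integral_add, intervalIntegral.integral_const_mul,
      intervalIntegral.integral_sub]
    · simp only [intervalIntegral.integral_const, smul_eq_mul]
      field_simp; ring
    · exact hci
    · exact _root_.intervalIntegrable_const
    · exact _root_.intervalIntegrable_const
    · exact (IntervalIntegrable.sub hci _root_.intervalIntegrable_const).const_mul _
  calc ENNReal.ofReal (2 * Real.pi * ‖h c‖ ^ p) ≤
      ENNReal.ofReal (2 * Real.pi * Real.circleAverage u c r) := by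
        apply ENNReal.ofReal_le_ofReal
        gcongr
        rw [havg]
        have : 0 ≤ p * ‖h c‖ ^ (p - 1) *
          (Real.circleAverage (fun z => ‖h z‖) c r - ‖h c‖) := by
          apply mul_nonneg (by positivity); linarith
        linarith
    _ ≤ _ := circ_avg_le u c r hcu
    _ ≤ _ := lintegral_mono fun θ => ENNReal.ofReal_le_ofReal
        (bernoulli_tangent hp (norm_nonneg _) hy)

lemma disc_mean {p : ℝ} (hp : 1 ≤ p) (h : ℂ → ℂ) (c : ℂ) (R : ℝ) (hR : 0 < R)
    (hm : Measurable h) (hd : DifferentiableOn ℂ h (Metric.ball c R)) :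
    ENNReal.ofReal (Real.pi * R ^ 2 * ‖h c‖ ^ p) ≤
      ∫⁻ z in Metric.ball c R, ENNReal.ofReal (‖h z‖ ^ p) := by
  have := ball_lower (fun z => ENNReal.ofReal (‖h z‖ ^ p))
    (ENNReal.measurable_ofReal.comp (hm.norm.pow_const p)) c R hR.le
    (ENNReal.ofReal (2 * Real.pi * ‖h c‖ ^ p)) (fun r hr => by
      apply circ_lower hp h c r hr.1
      apply DifferentiableOn.diffContOnCl
      rw [closure_ball _ hr.1.ne']
      exact hd.mono (Metric.closedBall_subset_ball hr.2))
  rw [← ENNReal.ofReal_mul (by positivity)] at this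
  convert this using 2
  ring

/-! ## The weight and point evaluations -/

/-- the weight in logarithmic coordinates -/
def wt (α t : ℝ) : ℝ := α * (max t 0) ^ 2

lemma phi_eq {α t : ℝ} {z : ℂ} (h : ‖z‖ = Real.exp t) : phi α z = wt α t := by
  simp [phi, wt, logPlus, h]

lemma wt_lower {α : ℝ} (hα : 0 < α) (s t : ℝ) :
    wt α t + 2 * α * max t 0 * (s - t) ≤ wt α s := by
  have h : (max t 0) ^ 2 + 2 * max t 0 * (s - t) ≤ (max s 0) ^ 2 := by
    rcases le_total t 0 with h1 | h1 <;> rcases le_total s 0 with h2 | h2 <;>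
      simp only [max_eq_right h1, max_eq_right h2, max_eq_left h1, max_eq_left h2] <;>
      nlinarith [sq_nonneg (s - t)]
  unfold wt
  nlinarith

lemma wt_upper {α : ℝ} (hα : 0 < α) (s t : ℝ) :
    wt α s ≤ wt α t + 2 * α * max t 0 * (s - t) + α * (s - t) ^ 2 := by
  have h : (max s 0) ^ 2 ≤ (max t 0) ^ 2 + 2 * max t 0 * (s - t) + (s - t) ^ 2 := by
    rcases le_total t 0 with h1 | h1 <;> rcases le_total s 0 with h2 | h2 <;>
      simp only [max_eq_right h1, max_eq_right h2, max_eq_left h1, max_eq_left h2] <;>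
      nlinarith [sq_nonneg (s - t), sq_nonneg t, sq_nonneg s, mul_nonneg_of_nonpos_of_nonpos (sub_nonpos.2 (min_le_right t 0)) (le_refl (0:ℝ))]
  unfold wt
  nlinarith

lemma wt_nonneg {α : ℝ} (hα : 0 < α) (t : ℝ) : 0 ≤ wt α t := by unfold wt; positivity

lemma log_close {t : ℝ} {z z0 : ℂ} (h0 : ‖z0‖ = Real.exp t)
    (hz : z ∈ Metric.ball z0 (Real.exp t / 2)) : z ≠ 0 ∧ |Real.log ‖z‖ - t| ≤ 1 := by
  have he := Real.exp_pos t
  rw [Metric.mem_ball, dist_eq_norm] at hz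
  have h1 : ‖z0‖ - ‖z‖ ≤ ‖z - z0‖ := by rw [norm_sub_rev]; exact norm_sub_norm_le _ _
  have h2 : ‖z‖ - ‖z0‖ ≤ ‖z - z0‖ := norm_sub_norm_le _ _
  have hpos : 0 < ‖z‖ := by linarith
  refine ⟨norm_pos_iff.1 hpos, ?_⟩
  have he1 : (2 : ℝ) ≤ Real.exp 1 := by linarith [Real.add_one_le_exp (1:ℝ)]
  have he2 : Real.exp (-1) ≤ 1 / 2 := by
    rw [Real.exp_neg, inv_le_comm₀ (Real.exp_pos _) (by norm_num)]; simpa using he1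
  rw [abs_le]
  constructor
  · have : t - 1 ≤ Real.log ‖z‖ := by
      rw [Real.le_log_iff_exp_le hpos, sub_eq_add_neg, Real.exp_add]
      nlinarith
    linarith
  · have : Real.log ‖z‖ ≤ t + 1 := by
      rw [Real.log_le_iff_le_exp hpos, Real.exp_add]
      nlinarith
    linarith

lemma measurable_phi (α : ℝ) : Measurable (phi α) := by
  unfold phi logPlus
  exact ((((Real.measurable_log.comp measurable_norm).max measurable_const).pow_const 2).const_mul α)

lemma measurable_fockint (α p : ℝ) {f : ℂ → ℂ} (hf : Continuous f) :
    Measurable fun z => ENNReal.ofReal ((‖f z‖ * Real.exp (-(phi α z))) ^ p) :=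
  ENNReal.measurable_ofReal.comp
    ((hf.measurable.norm.mul (Real.measurable_exp.comp (measurable_phi α).neg)).pow_const p)

lemma point_eval {α p : ℝ} (hα : 0 < α) (hp : 1 ≤ p) :
    ∃ C : ℝ, 0 < C ∧ ∀ f : ℂ → ℂ, Differentiable ℂ f → ∀ (z0 : ℂ) (t : ℝ), ‖z0‖ = Real.exp t →
      ENNReal.ofReal ((‖f z0‖ * Real.exp (-(wt α t))) ^ p * Real.exp (2 * t)) ≤
        ENNReal.ofReal C * ∫⁻ z in {z : ℂ | |Real.log ‖z‖ - t| ≤ 1},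
          ENNReal.ofReal ((‖f z‖ * Real.exp (-(phi α z))) ^ p) := by
  refine ⟨4 / Real.pi * Real.exp ((1 + α) * p), by positivity, ?_⟩
  intro f hf z0 t h0
  have he := Real.exp_pos t
  have hpi := Real.pi_pos
  set k : ℕ := ⌊2 * α * max t 0⌋₊ with hk
  have hk1 : (k : ℝ) ≤ 2 * α * max t 0 := Nat.floor_le (by positivity)
  have hk2 : 2 * α * max t 0 < k + 1 := Nat.lt_floor_add_one _
  set h : ℂ → ℂ := fun z => f z * (z0 / z) ^ k with hh
  have hm : Measurable h := by
    apply hf.continuous.measurable.mul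
    exact (measurable_const.div measurable_id).pow_const k
  have hd : DifferentiableOn ℂ h (Metric.ball z0 (Real.exp t / 2)) := by
    intro z hz
    have hz0 := (log_close h0 hz).1
    apply DifferentiableAt.differentiableWithinAt
    exact hf.differentiableAt.mul (((differentiableAt_const _).div differentiableAt_id hz0).pow k)
  have key := disc_mean hp h z0 _ (by positivity) hm hd
  have hz0 : z0 ≠ 0 := by rw [← norm_pos_iff, h0]; exact he
  have hhz : h z0 = f z0 := by simp [hh, div_self hz0]
  rw [hhz] at key
  have hbd : ∀ z ∈ Metric.ball z0 (Real.exp t / 2), ENNReal.ofReal (‖h z‖ ^ p) ≤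
      ENNReal.ofReal (Real.exp ((wt α t + 1 + α) * p)) *
        ENNReal.ofReal ((‖f z‖ * Real.exp (-(phi α z))) ^ p) := by
    intro z hz
    obtain ⟨hzn, hz1⟩ := log_close h0 hz
    rw [← ENNReal.ofReal_mul (by positivity)]
    apply ENNReal.ofReal_le_ofReal
    have hzp : 0 < ‖z‖ := norm_pos_iff.2 hzn
    have hzs : ‖z‖ = Real.exp (Real.log ‖z‖) := (Real.exp_log hzp).symm
    set s := Real.log ‖z‖
    rw [phi_eq hzs, Real.exp_mul, ← Real.mul_rpow (by positivity) (by positivity)]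
    apply Real.rpow_le_rpow (norm_nonneg _) _ (by linarith)
    have : ‖h z‖ = ‖f z‖ * Real.exp (k * (t - s)) := by
      simp only [hh, norm_mul, norm_pow, norm_div]
      rw [h0, hzs, ← Real.exp_sub, ← Real.exp_nat_mul]
    rw [this, show Real.exp (wt α t + 1 + α) * (‖f z‖ * Real.exp (-wt α s)) =
      ‖f z‖ * Real.exp (wt α t + 1 + α + -wt α s) by rw [Real.exp_add _ (-wt α s)]; ring]
    gcongr
    have h3 := wt_upper hα s t
    obtain ⟨h4, h5⟩ := abs_le.1 hz1
    have h6 : (s - t) ^ 2 ≤ 1 := by nlinarith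
    have h7 : (2 * α * max t 0 - k) * (s - t) ≤ 1 := by
      nlinarith [mul_nonneg (sub_nonneg.2 hk1) (sub_nonneg.2 h5)]
    nlinarith
  have hsub : Metric.ball z0 (Real.exp t / 2) ⊆ {z : ℂ | |Real.log ‖z‖ - t| ≤ 1} :=
    fun z hz => (log_close h0 hz).2
  have key2 := key.trans (setLIntegral_mono' measurableSet_ball hbd)
  rw [lintegral_const_mul _ (measurable_fockint α p hf.continuous)] at key2
  have key3 := key2.trans (mul_le_mul_right (lintegral_mono_set hsub) _)
  have e : (‖f z0‖ * Real.exp (-wt α t)) ^ p * Real.exp (2 * t) =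
      (4 / Real.pi * Real.exp (-(wt α t * p))) * (Real.pi * (Real.exp t / 2) ^ 2 * ‖f z0‖ ^ p) := by
    rw [Real.mul_rpow (by positivity) (by positivity), ← Real.exp_mul,
      show 2 * t = t + t by ring, Real.exp_add t t]
    field_simp
    norm_num
  rw [e, ENNReal.ofReal_mul (by positivity)]
  refine (mul_le_mul_right key3 _).trans (le_of_eq ?_)
  rw [← mul_assoc, ← ENNReal.ofReal_mul (by positivity)]
  congr 2
  rw [mul_assoc, ← Real.exp_add]
  ring_nf

/-- real version -/
lemma point_eval' {α p : ℝ} (hα : 0 < α) (hp : 1 ≤ p) :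
    ∃ C : ℝ, 0 < C ∧ ∀ f : ℂ → ℂ, MemFock α p f → ∀ (z0 : ℂ) (t : ℝ), ‖z0‖ = Real.exp t →
      (‖f z0‖ * Real.exp (-(wt α t))) ^ p * Real.exp (2 * t) ≤ C * (fockNormP α p f).toReal := by
  obtain ⟨C, hC, h⟩ := point_eval hα hp
  refine ⟨C, hC, fun f hf z0 t h0 => ?_⟩
  have h1 := (h f hf.1 z0 t h0).trans (mul_le_mul_right (setLIntegral_le_lintegral _ _) _)
  change _ ≤ ENNReal.ofReal C * fockNormP α p f at h1
  rw [← ENNReal.ofReal_toReal hf.2.ne, ← ENNReal.ofReal_mul hC.le] at h1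
  exact (ENNReal.ofReal_le_ofReal_iff (by positivity)).1 h1

/-- logarithmic version -/
lemma point_eval_log {α p : ℝ} (hα : 0 < α) (hp : 1 ≤ p) {K : ℝ} (hK : 0 < K) {f : ℂ → ℂ}
    {z0 : ℂ} {t : ℝ}
    (h : (‖f z0‖ * Real.exp (-(wt α t))) ^ p * Real.exp (2 * t) ≤ K) :
    ‖f z0‖ ≤ Real.exp (Real.log K / p + wt α t - 2 * t / p) := by
  have hp0 : 0 < p := by linarith
  have h1 : (‖f z0‖ * Real.exp (-(wt α t) + 2 * t / p)) ^ p ≤ K := by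
    refine le_trans (le_of_eq ?_) h
    rw [Real.exp_add, ← mul_assoc, Real.mul_rpow (by positivity) (by positivity),
      ← Real.exp_mul (2 * t / p)]
    congr 2; field_simp
  have h2 : ‖f z0‖ * Real.exp (-(wt α t) + 2 * t / p) ≤ Real.exp (Real.log K / p) := by
    have := Real.rpow_le_rpow (by positivity) h1 (z := 1 / p) (by positivity)
    rw [← Real.rpow_mul (by positivity), mul_one_div_cancel hp0.ne', Real.rpow_one] at this
    rwa [Real.rpow_def_of_pos hK, mul_one_div] at this
  rw [show Real.log K / p + wt α t - 2 * t / p = Real.log K / p - (-(wt α t) + 2 * t / p) by ring,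
    Real.exp_sub, le_div_iff₀ (Real.exp_pos _)]
  exact h2

/-! ## Sums of exponentials and the counting function -/

lemma summable_int_exp {a : ℝ} (ha : 0 < a) : Summable fun i : ℤ => Real.exp (-a * |(i : ℝ)|) := by
  have h1 : Summable fun n : ℕ => Real.exp (-a * |((n : ℤ) : ℝ)|) := by
    have := Real.summable_exp_nat_mul_iff.2 (neg_lt_zero.2 ha)
    refine this.congr fun n => ?_
    rw [Int.cast_natCast, abs_of_nonneg (Nat.cast_nonneg n), mul_comm]
  refine Summable.of_nat_of_neg h1 ?_
  refine h1.congr fun n => ?_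
  simp

lemma expsum_int {a : ℝ} (ha : 0 < a) (y : ℝ) :
    Summable (fun k : ℕ => Real.exp (-a * |y - k|)) ∧
      ∑' k : ℕ, Real.exp (-a * |y - k|) ≤
        Real.exp a * ∑' i : ℤ, Real.exp (-a * |(i : ℝ)|) := by
  have hs := summable_int_exp ha
  have hb : ∀ k : ℕ, Real.exp (-a * |y - k|) ≤
      Real.exp a * Real.exp (-a * |((⌊y⌋ - (k : ℤ) : ℤ) : ℝ)|) := by
    intro k
    rw [← Real.exp_add]
    apply Real.exp_le_exp.2
    have h1 := Int.floor_le y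
    have h2 := Int.lt_floor_add_one y
    have h3 : |((⌊y⌋ - (k : ℤ) : ℤ) : ℝ)| ≤ |y - k| + 1 := by
      push_cast
      have : (⌊y⌋ : ℝ) - k = (y - k) + (⌊y⌋ - y) := by ring
      rw [this]
      refine (abs_add_le _ _).trans ?_
      gcongr
      rw [abs_le]; constructor <;> linarith
    nlinarith
  have hinj : Function.Injective (fun k : ℕ => ⌊y⌋ - (k : ℤ)) := by
    intro a b h; simp only at h; omega
  have hs2 : Summable fun k : ℕ => Real.exp a * Real.exp (-a * |((⌊y⌋ - (k : ℤ) : ℤ) : ℝ)|) :=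
    (hs.comp_injective hinj).mul_left _
  have hs3 := Summable.of_nonneg_of_le (fun k => (Real.exp_pos _).le) hb hs2
  refine ⟨hs3, (hs3.tsum_le_tsum hb hs2).trans ?_⟩
  rw [tsum_mul_left]
  gcongr
  exact tsum_comp_le_tsum_of_inj hs (fun i => (Real.exp_pos _).le) hinj

lemma expsum (c ε B : ℝ) (hc : 0 < c) (hε : 0 < ε) :
    ∃ C : ℝ, 0 < C ∧ ∀ τ : ℕ → ℝ, (∀ k, |τ k - c * k| ≤ B) → ∀ x : ℝ,
      Summable (fun k : ℕ => Real.exp (-ε * |x - τ k|)) ∧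
      ∑' k : ℕ, Real.exp (-ε * |x - τ k|) ≤ C := by
  have ha : 0 < ε * c := by positivity
  have hpos : 0 < ∑' i : ℤ, Real.exp (-(ε * c) * |(i : ℝ)|) :=
    (summable_int_exp ha).tsum_pos (fun _ => (Real.exp_pos _).le) 0 (Real.exp_pos _)
  refine ⟨Real.exp (ε * B) * (Real.exp (ε * c) * ∑' i : ℤ, Real.exp (-(ε * c) * |(i : ℝ)|)),
    by positivity, fun τ hτ x => ?_⟩
  obtain ⟨h1, h2⟩ := expsum_int ha (x / c)
  have hb : ∀ k : ℕ, Real.exp (-ε * |x - τ k|) ≤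
      Real.exp (ε * B) * Real.exp (-(ε * c) * |x / c - k|) := by
    intro k
    rw [← Real.exp_add]
    apply Real.exp_le_exp.2
    have e : c * |x / c - k| = |x - c * k| := by
      rw [← abs_of_pos hc, ← abs_mul, abs_of_pos hc]; congr 1; field_simp
    have h3 : |x - c * k| ≤ |x - τ k| + B := by
      rw [show x - c * k = (x - τ k) + (τ k - c * k) by ring]
      exact (abs_add_le _ _).trans (by gcongr; exact hτ k)
    rw [neg_mul, neg_mul, mul_assoc, e]
    nlinarith
  have h4 := h1.mul_left (Real.exp (ε * B))
  have h5 := Summable.of_nonneg_of_le (fun k => (Real.exp_pos _).le) hb h4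
  refine ⟨h5, (h5.tsum_le_tsum hb h4).trans ?_⟩
  rw [tsum_mul_left]
  gcongr

/-- the integrated counting function -/
def Sf (τ : ℕ → ℝ) (t : ℝ) : ℝ := ∑' k, max (t - τ k) 0

def Df (α p : ℝ) (τ : ℕ → ℝ) (m : ℕ) : ℝ :=
  ∑ k ∈ Finset.range m, (1 / (4 * α) + 1 / (p * α) - (τ k - 1 / (2 * α) * k))

lemma sum_range_id_real (m : ℕ) : ∑ k ∈ Finset.range m, (k : ℝ) = m * (m - 1) / 2 := by
  induction m with
  | zero => simp
  | succ n ih => rw [Finset.sum_range_succ, ih]; push_cast; ring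

lemma Sf_summable {c B : ℝ} {τ : ℕ → ℝ} (hc : 0 < c) (hτ : ∀ k, |τ k - c * k| ≤ B) (t : ℝ) :
    Summable fun k => max (t - τ k) 0 := by
  apply summable_of_hasFiniteSupport
  apply (Set.finite_lt_nat (⌈(t + B) / c⌉₊ + 1)).subset
  intro k hk
  simp only [Function.mem_support, ne_eq, max_eq_right_iff, not_le] at hk
  have h1 := (abs_le.1 (hτ k)).1
  have h2 : (k : ℝ) < (t + B) / c := by rw [lt_div_iff₀ hc]; linarith
  have h3 := Nat.le_ceil ((t + B) / c)
  have : (k : ℝ) < ⌈(t + B) / c⌉₊ := by linarith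
  have h4 : k < ⌈(t + B) / c⌉₊ := by exact_mod_cast this
  simp only [Set.mem_setOf_eq]; omega

lemma Sf_near (c B B' : ℝ) (hc : 0 < c) :
    ∃ C : ℝ, ∀ τ : ℕ → ℝ, (∀ k, |τ k - c * k| ≤ B) → ∀ (m : ℕ) (t : ℝ), |t - c * m| ≤ B' →
      |Sf τ t - ∑ k ∈ Finset.range m, (t - τ k)| ≤ C := by
  obtain ⟨C, hC, hE⟩ := expsum c 1 B hc one_pos
  refine ⟨(B + B') * Real.exp (B + B') * C, fun τ hτ m t ht => ?_⟩
  obtain ⟨h1, h2⟩ := hE τ hτ t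
  have hB : 0 ≤ B := (abs_nonneg _).trans (hτ 0)
  have hB' : 0 ≤ B' := (abs_nonneg _).trans ht
  obtain ⟨t1, t2⟩ := abs_le.1 ht
  have hS := Sf_summable hc hτ t
  have e : ∑ k ∈ Finset.range m, (t - τ k) = ∑' k, if k < m then (t - τ k) else 0 := by
    rw [tsum_eq_sum (s := Finset.range m)]
    · refine Finset.sum_congr rfl fun k hk => ?_
      rw [if_pos (Finset.mem_range.1 hk)]
    · intro k hk; rw [if_neg (by simpa using hk)]
  have hS2 : Summable fun k => if k < m then (t - τ k) else 0 := by
    apply summable_of_hasFiniteSupport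
    apply (Set.finite_lt_nat m).subset
    intro k hk
    by_contra h
    simp only [Set.mem_setOf_eq] at h
    simp [h] at hk
  rw [e, Sf, ← hS.tsum_sub hS2]
  have hb : ∀ k, |max (t - τ k) 0 - (if k < m then (t - τ k) else 0)| ≤
      (B + B') * Real.exp (B + B') * Real.exp (-1 * |t - τ k|) := by
    intro k
    obtain ⟨k1, k2⟩ := abs_le.1 (hτ k)
    have gen : ∀ y : ℝ, 0 ≤ y → y ≤ B + B' → y ≤ (B + B') * Real.exp (B + B') * Real.exp (-1 * y) := by
      intro y hy hy'
      rw [mul_assoc, ← Real.exp_add]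
      have : 1 ≤ Real.exp (B + B' + -1 * y) := Real.one_le_exp (by linarith)
      nlinarith
    have pos : 0 ≤ (B + B') * Real.exp (B + B') * Real.exp (-1 * |t - τ k|) := by positivity
    split_ifs with hk
    · have hk' : c * k ≤ c * m := by gcongr
      rcases le_total 0 (t - τ k) with h | h
      · rw [max_eq_left h]; simpa using pos
      · rw [max_eq_right h, zero_sub, abs_neg, ]
        apply gen _ (abs_nonneg _)
        rw [abs_of_nonpos h]; linarith
    · have hk' : c * m ≤ c * k := by
        have : (m : ℝ) ≤ k := by exact_mod_cast not_lt.1 hk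
        gcongr
      rcases le_total 0 (t - τ k) with h | h
      · rw [max_eq_left h, sub_zero]
        apply gen _ (abs_nonneg _)
        rw [abs_of_nonneg h]; linarith
      · rw [max_eq_right h]; simpa using pos
  have hs3 := h1.mul_left ((B + B') * Real.exp (B + B'))
  have := tsum_of_norm_bounded hs3.hasSum (fun k => by rw [Real.norm_eq_abs]; exact hb k)
  rw [Real.norm_eq_abs, tsum_mul_left] at this
  refine this.trans ?_
  gcongr

lemma HD (α p B B' : ℝ) (hα : 0 < α) (hp : 1 ≤ p) :
    ∃ C : ℝ, ∀ τ : ℕ → ℝ, (∀ k, |τ k - 1 / (2 * α) * k| ≤ B) → ∀ (m : ℕ) (t : ℝ),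
      |t - 1 / (2 * α) * m| ≤ B' →
      |Sf τ t - wt α t + 2 * t / p - Df α p τ m| ≤ C := by
  obtain ⟨C, hC⟩ := Sf_near (1 / (2 * α)) B B' (by positivity)
  refine ⟨C + 2 * α * B' ^ 2 + 2 * B', fun τ hτ m t ht => ?_⟩
  have h := hC τ hτ m t ht
  set u := t - 1 / (2 * α) * m with hu
  have hB' : 0 ≤ B' := (abs_nonneg _).trans ht
  obtain ⟨t1, t2⟩ := abs_le.1 ht
  have hw : |wt α t - α * t ^ 2| ≤ α * B' ^ 2 := by
    unfold wt
    rcases le_total 0 t with h0 | h0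
    · rw [max_eq_left h0]; simp; positivity
    · have : 0 ≤ 1 / (2 * α) * m := by positivity
      have h1 : t ^ 2 ≤ B' ^ 2 := by nlinarith
      rw [max_eq_right h0, abs_le]; constructor <;> nlinarith [sq_nonneg t]
  have hD : Df α p τ m = ∑ k ∈ Finset.range m, (t - τ k) - α * t ^ 2 + 2 * t / p + α * u ^ 2
      - 2 * u / p := by
    unfold Df
    have hsum := sum_range_id_real m
    rw [Finset.sum_sub_distrib, Finset.sum_sub_distrib, Finset.sum_sub_distrib, ← Finset.mul_sum,
      hsum, show t = 1 / (2 * α) * m + u by rw [hu]; ring]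
    simp only [Finset.sum_const, Finset.card_range, nsmul_eq_mul]
    field_simp
    ring
  have hu2 : α * u ^ 2 ≤ α * B' ^ 2 := by
    have : u ^ 2 ≤ B' ^ 2 := by nlinarith
    gcongr
  have hu3 : |2 * u / p| ≤ 2 * B' := by
    rw [abs_div, abs_mul, abs_of_pos (by linarith : 0 < p), div_le_iff₀ (by linarith)]
    norm_num
    nlinarith
  rw [hD]
  have hu4 : 0 ≤ α * u ^ 2 := by positivity
  rw [abs_le] at *
  constructor <;> linarith [h.1, h.2, hw.1, hw.2, hu3.1, hu3.2]

/-! ## The discrete norm over a range -/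

lemma disc_range {α p : ℝ} {g : ℕ → ℂ} (hg : Function.Injective g) (v : ℂ → ℂ) :
    (∑' lam : Set.range g, ENNReal.ofReal
      ((1 + ‖(lam : ℂ)‖) ^ 2 * ‖v (lam : ℂ)‖ ^ p *
        Real.exp (-(p * phi α (lam : ℂ))))) =
    ∑' k, ENNReal.ofReal ((1 + ‖g k‖) ^ 2 * ‖v (g k)‖ ^ p * Real.exp (-(p * phi α (g k)))) := by
  rw [← (Equiv.ofInjective g hg).tsum_eq]
  rfl

lemma disc_term {α p τ : ℝ} {w : ℂ} (h : ‖w‖ = Real.exp τ) (x : ℝ) (hx : 0 ≤ x) :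
    (1 + ‖w‖) ^ 2 * x ^ p * Real.exp (-(p * phi α w)) =
    (1 + Real.exp τ) ^ 2 * (x * Real.exp (-(wt α τ))) ^ p := by
  rw [phi_eq h, h, Real.mul_rpow hx (by positivity), ← Real.exp_mul]
  ring_nf

lemma disc_upper {α p B : ℝ} (hα : 0 < α) (hp : 1 ≤ p) {g : ℕ → ℂ} (hg : Function.Injective g)
    {τ : ℕ → ℝ} (hgτ : ∀ k, ‖g k‖ = Real.exp (τ k)) (hτ : ∀ k, |τ k - 1 / (2 * α) * k| ≤ B) :
    ∃ C : ℝ, 0 < C ∧ ∀ f, MemFock α p f →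
      discNormP α p (Set.range g) f ≤ ENNReal.ofReal C * fockNormP α p f := by
  obtain ⟨C1, hC1, h1⟩ := point_eval hα hp
  obtain ⟨C2, hC2, h2⟩ := expsum (1 / (2 * α)) 1 B (by positivity) one_pos
  refine ⟨(1 + Real.exp B) ^ 2 * C1 * (Real.exp 1 * C2), by positivity, fun f hf => ?_⟩
  set F : ℂ → ℝ≥0∞ := fun z => ENNReal.ofReal ((‖f z‖ * Real.exp (-(phi α z))) ^ p) with hF
  have hFm : Measurable F := measurable_fockint α p hf.1.continuous
  have hAm : ∀ k, MeasurableSet {z : ℂ | |Real.log ‖z‖ - τ k| ≤ 1} := fun k =>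
    measurableSet_le ((Real.measurable_log.comp measurable_norm).sub_const _).abs measurable_const
  have hterm : ∀ k, ENNReal.ofReal ((1 + ‖g k‖) ^ 2 * ‖f (g k)‖ ^ p *
      Real.exp (-(p * phi α (g k)))) ≤ ENNReal.ofReal ((1 + Real.exp B) ^ 2 * C1) *
        ∫⁻ z, ({z : ℂ | |Real.log ‖z‖ - τ k| ≤ 1}.indicator F) z := by
    intro k
    rw [disc_term (hgτ k) _ (norm_nonneg _), lintegral_indicator (hAm k),
      ENNReal.ofReal_mul (p := (1 + Real.exp B) ^ 2) (by positivity), mul_assoc]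
    have := h1 f hf.1 (g k) (τ k) (hgτ k)
    refine le_trans ?_ (mul_le_mul_right this _)
    rw [← ENNReal.ofReal_mul (by positivity)]
    apply ENNReal.ofReal_le_ofReal
    have h3 : 1 + Real.exp (τ k) ≤ (1 + Real.exp B) * Real.exp (τ k) := by
      rw [add_mul, ← Real.exp_add, one_mul, add_comm]
      gcongr
      apply Real.one_le_exp
      have := (abs_le.1 (hτ k)).1
      have : 0 ≤ 1 / (2 * α) * k := by positivity
      linarith
    calc (1 + Real.exp (τ k)) ^ 2 * (‖f (g k)‖ * Real.exp (-wt α (τ k))) ^ p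
        ≤ ((1 + Real.exp B) * Real.exp (τ k)) ^ 2 * (‖f (g k)‖ * Real.exp (-wt α (τ k))) ^ p := by
          gcongr
      _ = _ := by rw [show 2 * τ k = τ k + τ k by ring, Real.exp_add]; ring
  unfold discNormP
  rw [disc_range hg]
  refine (ENNReal.tsum_le_tsum hterm).trans ?_
  rw [ENNReal.tsum_mul_left, ← lintegral_tsum (fun k => (hFm.indicator (hAm k)).aemeasurable),
    ENNReal.ofReal_mul (p := (1 + Real.exp B) ^ 2 * C1) (by positivity),
    mul_assoc (ENNReal.ofReal ((1 + Real.exp B) ^ 2 * C1)), fockNormP,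
    ← lintegral_const_mul _ (measurable_fockint α p hf.1.continuous)]
  refine mul_le_mul_right (lintegral_mono fun z => ?_) _
  change _ ≤ _ * F z
  obtain ⟨h4, h5⟩ := h2 τ hτ (Real.log ‖z‖)
  calc ∑' k, ({z : ℂ | |Real.log ‖z‖ - τ k| ≤ 1}.indicator F) z
      ≤ ∑' k, ENNReal.ofReal (Real.exp 1 * Real.exp (-1 * |Real.log ‖z‖ - τ k|)) * F z := by
        refine ENNReal.tsum_le_tsum fun k => ?_
        by_cases hk : z ∈ {z : ℂ | |Real.log ‖z‖ - τ k| ≤ 1}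
        · rw [Set.indicator_of_mem hk]
          conv_lhs => rw [← one_mul (F z)]
          gcongr
          rw [← ENNReal.ofReal_one]
          apply ENNReal.ofReal_le_ofReal
          rw [← Real.exp_add]
          apply Real.one_le_exp
          have : |Real.log ‖z‖ - τ k| ≤ 1 := hk
          linarith
        · rw [Set.indicator_of_notMem hk]; exact bot_le
    _ = ENNReal.ofReal (∑' k, Real.exp 1 * Real.exp (-1 * |Real.log ‖z‖ - τ k|)) * F z := by
        rw [ENNReal.tsum_mul_right, ENNReal.ofReal_tsum_of_nonneg (fun k => by positivity)
          (h4.mul_left _)]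
    _ ≤ _ := by
        gcongr
        rw [tsum_mul_left]
        gcongr

/-! ## Jensen's formula -/

lemma entire_nhd {h : ℂ → ℂ} (hh : Differentiable ℂ h) (U : Set ℂ) : AnalyticOnNhd ℂ h U :=
  fun z _ => hh.analyticAt z

lemma log_int {h : ℂ → ℂ} (hh : Differentiable ℂ h) (c : ℂ) (R : ℝ) :
    CircleIntegrable (fun z => Real.log ‖h z‖) c R :=
  (entire_nhd hh _).meromorphicOn.circleIntegrable_log_norm

lemma order_ne_top {h : ℂ → ℂ} (hh : Differentiable ℂ h) {c : ℂ} (hc : h c ≠ 0) (u : ℂ) :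
    analyticOrderAt h u ≠ ⊤ := by
  intro ht
  rw [analyticOrderAt_eq_top] at ht
  have := (entire_nhd hh Set.univ).eqOn_zero_of_preconnected_of_eventuallyEq_zero
    isPreconnected_univ (Set.mem_univ u) ht
  exact hc (this (Set.mem_univ c))

lemma jensen_lower {h : ℂ → ℂ} (hh : Differentiable ℂ h) {c : ℂ} (hc : h c ≠ 0) {R : ℝ}
    (hR : 0 < R) (s : Finset ℂ) (hs : ∀ u ∈ s, h u = 0) :
    ∑ u ∈ s, max (Real.log R - Real.log ‖c - u‖) 0 + Real.log ‖h c‖ ≤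
      Real.circleAverage (fun z => Real.log ‖h z‖) c R := by
  have hA := entire_nhd hh (Metric.closedBall c |R|)
  rw [AnalyticOnNhd.circleAverage_log_norm hR.ne' hA hc]
  gcongr
  set d := MeromorphicOn.divisor h (Metric.closedBall c |R|) with hd
  have hfin : (Function.support fun u => (d u : ℝ) * Real.log (R * ‖c - u‖⁻¹)).Finite := by
    apply (d.finiteSupport (isCompact_closedBall c |R|)).subset
    intro u hu
    simp only [Function.mem_support] at hu ⊢
    intro h0; simp [h0] at hu
  have hsub : (Function.support fun u => (d u : ℝ) * Real.log (R * ‖c - u‖⁻¹)) ⊆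
      ((hfin.toFinset ∪ s : Finset ℂ) : Set ℂ) := by
    intro u hu; simp [hu]; left; simpa using hu
  rw [finsum_eq_sum_of_support_subset _ hsub]
  have hnn : ∀ u, 0 ≤ (d u : ℝ) * Real.log (R * ‖c - u‖⁻¹) := by
    intro u
    by_cases hu : u ∈ Metric.closedBall c |R|
    · have h1 : (0 : ℤ) ≤ d u := MeromorphicOn.AnalyticOnNhd.divisor_nonneg hA u
      apply mul_nonneg (by exact_mod_cast h1)
      rcases eq_or_ne c u with rfl | hcu
      · simp
      · apply Real.log_nonneg
        have : 0 < ‖c - u‖ := norm_pos_iff.2 (sub_ne_zero.2 hcu)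
        rw [← div_eq_mul_inv, one_le_div this]
        rw [Metric.mem_closedBall, dist_comm, dist_eq_norm, abs_of_pos hR] at hu
        exact hu
    · rw [d.apply_eq_zero_of_notMem hu]; simp
  refine le_trans (Finset.sum_le_sum fun u hu => ?_) (Finset.sum_le_sum_of_subset_of_nonneg
    (Finset.subset_union_right (s₁ := hfin.toFinset)) fun u _ _ => hnn u)
  apply max_le _ (hnn u)
  have hcu : c ≠ u := by rintro rfl; exact hc (hs _ hu)
  have hpos : 0 < ‖c - u‖ := norm_pos_iff.2 (sub_ne_zero.2 hcu)
  rw [← div_eq_mul_inv, Real.log_div hR.ne' hpos.ne']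
  by_cases hu' : u ∈ Metric.closedBall c |R|
  · have h1 : (1 : ℤ) ≤ d u := by
      rw [hd, MeromorphicOn.AnalyticOnNhd.divisor_apply hA hu']
      have e1 := order_ne_top hh hc u
      have e2 := (hh.analyticAt u).analyticOrderAt_ne_zero.2 (hs u hu)
      lift analyticOrderAt h u to ℕ using e1 with n hn
      have : n ≠ 0 := by exact_mod_cast e2
      change (1 : ℤ) ≤ (n : ℤ)
      omega
    have h2 : (1 : ℝ) ≤ d u := by exact_mod_cast h1
    have h3 : 0 ≤ Real.log R - Real.log ‖c - u‖ := by
      rw [Metric.mem_closedBall, dist_comm, dist_eq_norm, abs_of_pos hR] at hu'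
      have := Real.log_le_log hpos hu'
      linarith
    nlinarith
  · rw [d.apply_eq_zero_of_notMem hu']
    rw [Metric.mem_closedBall, dist_comm, dist_eq_norm, abs_of_pos hR] at hu'
    have := Real.log_le_log hR (le_of_not_ge hu')
    simp; linarith

lemma jensen_exact {h : ℂ → ℂ} (hh : Differentiable ℂ h) {c : ℂ} (hc : h c ≠ 0) {R : ℝ}
    (hR : 0 < R) (s : Finset ℂ) (hs : ∀ u ∈ s, h u = 0 ∧ deriv h u ≠ 0)
    (hs' : ∀ u ∈ Metric.closedBall c R, h u = 0 → u ∈ s) :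
    Real.circleAverage (fun z => Real.log ‖h z‖) c R =
    ∑ u ∈ s, max (Real.log R - Real.log ‖c - u‖) 0 + Real.log ‖h c‖ := by
  have hA := entire_nhd hh (Metric.closedBall c |R|)
  rw [AnalyticOnNhd.circleAverage_log_norm hR.ne' hA hc]
  congr 1
  set d := MeromorphicOn.divisor h (Metric.closedBall c |R|) with hd
  have hsub : (Function.support fun u => (d u : ℝ) * Real.log (R * ‖c - u‖⁻¹)) ⊆
      (s : Set ℂ) := by
    intro u hu
    simp only [Function.mem_support] at hu
    have h1 : u ∈ Metric.closedBall c |R| := by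
      by_contra hu'
      rw [d.apply_eq_zero_of_notMem hu'] at hu
      simp at hu
    apply hs' u (by rwa [abs_of_pos hR] at h1)
    by_contra h0
    rw [hd, MeromorphicOn.AnalyticOnNhd.divisor_apply hA h1,
      (hh.analyticAt u).analyticOrderAt_eq_zero.2 h0] at hu
    simp at hu
  rw [finsum_eq_sum_of_support_subset _ hsub]
  refine Finset.sum_congr rfl fun u hu => ?_
  have hcu : c ≠ u := by rintro rfl; exact hc (hs _ hu).1
  have hpos : 0 < ‖c - u‖ := norm_pos_iff.2 (sub_ne_zero.2 hcu)
  rw [← div_eq_mul_inv, Real.log_div hR.ne' hpos.ne']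
  by_cases hu' : u ∈ Metric.closedBall c |R|
  · have h1 : d u = (1 : ℤ) := by
      rw [hd, MeromorphicOn.AnalyticOnNhd.divisor_apply hA hu',
        (hh.analyticAt u).analyticOrderAt_eq_one_of_zero_deriv_ne_zero (hs u hu).1 (hs u hu).2]
      rfl
    have h3 : 0 ≤ Real.log R - Real.log ‖c - u‖ := by
      rw [Metric.mem_closedBall, dist_comm, dist_eq_norm, abs_of_pos hR] at hu'
      have := Real.log_le_log hpos hu'
      linarith
    rw [h1, max_eq_left h3]; simp
  · rw [d.apply_eq_zero_of_notMem hu']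
    rw [Metric.mem_closedBall, dist_comm, dist_eq_norm, abs_of_pos hR] at hu'
    have := Real.log_le_log hR (le_of_not_ge hu')
    rw [max_eq_right (by linarith)]; simp

lemma jensen_ineq {h : ℂ → ℂ} (hh : Differentiable ℂ h) {c : ℂ} (hc : h c ≠ 0) {R : ℝ}
    (hR : 0 < R) :
    Real.log ‖h c‖ ≤ Real.circleAverage (fun z => Real.log ‖h z‖) c R := by
  simpa using jensen_lower hh hc hR ∅ (by simp)

lemma circ_nonzero_ae {h : ℂ → ℂ} (hh : Differentiable ℂ h) {c : ℂ} (hc : h c ≠ 0) {a : ℂ} {R : ℝ}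
    (hR : 0 < R) :
    ∀ᵐ θ : ℝ, h (circleMap a R θ) ≠ 0 := by
  have hA := entire_nhd hh Set.univ
  have h1 : h ⁻¹' {0}ᶜ ∈ Filter.codiscrete ℂ :=
    hA.preimage_zero_mem_codiscrete (x := c) hc
  have h2 := circleMap_preimage_codiscrete (c := a) hR.ne'
  have h3 : (circleMap a R) ⁻¹' (h ⁻¹' {0}ᶜ) ∈ Filter.codiscrete ℝ := by
    apply h2
    exact Filter.codiscreteWithin_mono (Set.subset_univ _) h1
  have := ae_restrict_le_codiscreteWithin (μ := (volume : Measure ℝ)) (U := Set.univ) MeasurableSet.univ h3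
  rw [Measure.restrict_univ] at this
  exact this

/-! ## Canonical products -/

lemma prod_entire (a : ℕ → ℂ) (ha : Summable fun k => ‖a k‖) :
    ∃ P : ℂ → ℂ, Differentiable ℂ P ∧ ∀ z, HasProd (fun k => 1 + a k * z) (P z) := by
  refine ⟨fun z => ∏' k, (1 + a k * z), ?_, ?_⟩
  · rw [← differentiableOn_univ]
    intro z _
    apply DifferentiableAt.differentiableWithinAt
    have h1 : HasProdLocallyUniformlyOn (fun (k : ℕ) (x : ℂ) => 1 + a k * x)
        (fun x => ∏' k, (1 + a k * x)) (Metric.ball 0 (‖z‖ + 1)) := by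
      apply Summable.hasProdLocallyUniformlyOn_nat_one_add Metric.isOpen_ball
        (u := fun k => ‖a k‖ * (‖z‖ + 1)) (ha.mul_right _)
      · filter_upwards with n x hx
        rw [norm_mul]
        gcongr
        simpa using (mem_ball_zero_iff.1 hx).le
      · intro n; fun_prop
    have h2 := h1.tendstoLocallyUniformlyOn_finsetRange
    have h3 : DifferentiableOn ℂ (fun x => ∏' k, (1 + a k * x)) (Metric.ball 0 (‖z‖ + 1)) := by
      apply h2.differentiableOn _ Metric.isOpen_ball
      filter_upwards with N
      apply DifferentiableOn.fun_finsetProd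
      intro i _
      fun_prop
    exact h3.differentiableAt (Metric.isOpen_ball.mem_nhds (by simp))
  · intro z
    apply Multipliable.hasProd
    apply multipliable_one_add_of_summable
    refine Summable.of_norm ?_
    simp only [norm_mul]
    exact (ha.mul_right ‖z‖).congr (fun k => by simp)

lemma hasProd_le_exp {f : ℕ → ℂ} {P : ℂ} {x : ℕ → ℝ} {X : ℝ} (hf : HasProd f P) (hx : HasSum x X)
    (h : ∀ k, ‖f k‖ ≤ Real.exp (x k)) : ‖P‖ ≤ Real.exp X := by
  refine le_of_tendsto_of_tendsto' hf.tendsto_prod_nat.norm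
    ((Real.continuous_exp.tendsto _).comp hx.tendsto_sum_nat) fun N => ?_
  simp only [Function.comp, norm_prod, Real.exp_sum]
  exact Finset.prod_le_prod (fun _ _ => norm_nonneg _) fun k _ => h k

lemma exp_le_hasProd {f : ℕ → ℂ} {P : ℂ} {x : ℕ → ℝ} {X : ℝ} (hf : HasProd f P) (hx : HasSum x X)
    (h : ∀ k, Real.exp (x k) ≤ ‖f k‖) : Real.exp X ≤ ‖P‖ := by
  refine le_of_tendsto_of_tendsto'
    ((Real.continuous_exp.tendsto _).comp hx.tendsto_sum_nat) hf.tendsto_prod_nat.norm fun N => ?_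
  simp only [Function.comp, norm_prod, Real.exp_sum]
  exact Finset.prod_le_prod (fun _ _ => (Real.exp_pos _).le) fun k _ => h k

lemma one_add_exp_le (x : ℝ) : 1 + Real.exp x ≤ Real.exp (max x 0 + Real.exp (-1 * |x|)) := by
  rcases le_total 0 x with h | h
  · rw [max_eq_left h, abs_of_nonneg h, Real.exp_add]
    have h1 := Real.add_one_le_exp (Real.exp (-1 * x))
    have h2 : Real.exp x * Real.exp (-1 * x) = 1 := by rw [← Real.exp_add]; simp
    nlinarith [Real.exp_pos x]
  · rw [max_eq_right h, abs_of_nonpos h, zero_add]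
    have h1 := Real.add_one_le_exp (Real.exp (-1 * -x))
    rw [show -1 * -x = x by ring] at *
    linarith

lemma exp_le_one_sub {y : ℝ} (h0 : 0 ≤ y) (h1 : y ≤ 1 / 2) : Real.exp (-(2 * y)) ≤ 1 - y := by
  have h2 := Real.add_one_le_exp (2 * y)
  have h3 : Real.exp (-(2 * y)) * Real.exp (2 * y) = 1 := by rw [← Real.exp_add]; simp
  have h4 := Real.exp_pos (-(2 * y))
  have h5 : 1 ≤ (2 * y + 1) * (1 - y) := by nlinarith
  have h6 : 1 ≤ Real.exp (2 * y) * (1 - y) := by nlinarith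
  nlinarith

lemma one_sub_lower {κ x : ℝ} (hκ : 0 < κ) {w : ℂ} (hw : ‖w‖ = Real.exp x)
    (hs : κ * min 1 (Real.exp x) ≤ ‖1 - w‖) :
    Real.exp (max x 0 - Real.exp 1 * (2 + |Real.log κ|) * Real.exp (-1 * |x|)) ≤ ‖1 - w‖ := by
  have he1 : (2 : ℝ) ≤ Real.exp 1 := by linarith [Real.add_one_le_exp (1:ℝ)]
  have he2 : Real.exp (-1) ≤ 1 / 2 := by
    rw [Real.exp_neg, inv_le_comm₀ (Real.exp_pos _) (by norm_num)]; simpa using he1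
  have hC : 2 ≤ Real.exp 1 * (2 + |Real.log κ|) := by nlinarith [abs_nonneg (Real.log κ)]
  have hx0 := Real.exp_pos x
  have hn1 : ‖w‖ - 1 ≤ ‖1 - w‖ := by
    have := norm_sub_norm_le w 1
    rwa [norm_one, norm_sub_rev] at this
  have hn2 : 1 - ‖w‖ ≤ ‖1 - w‖ := by
    have := norm_sub_norm_le 1 w
    rwa [norm_one] at this
  rcases le_or_gt 1 x with h | h
  · have h3 : Real.exp (-x) ≤ 1 / 2 := le_trans (Real.exp_le_exp.2 (by linarith)) he2
    have h4 := exp_le_one_sub (Real.exp_pos (-x)).le h3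
    rw [max_eq_left (by linarith), abs_of_nonneg (show 0 ≤ x by linarith)]
    calc _ ≤ Real.exp (x + -(2 * Real.exp (-x))) := by
          apply Real.exp_le_exp.2
          rw [neg_one_mul]
          nlinarith [Real.exp_pos (-x)]
      _ = Real.exp x * Real.exp (-(2 * Real.exp (-x))) := Real.exp_add _ _
      _ ≤ Real.exp x * (1 - Real.exp (-x)) := by gcongr
      _ = ‖w‖ - 1 := by rw [hw, mul_sub, ← Real.exp_add]; simp
      _ ≤ _ := hn1
  rcases le_or_gt x (-1) with h' | h'
  · have h3 : Real.exp x ≤ 1 / 2 := le_trans (Real.exp_le_exp.2 (by linarith)) he2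
    have h4 := exp_le_one_sub (Real.exp_pos x).le h3
    rw [max_eq_right (by linarith), abs_of_nonpos (show x ≤ 0 by linarith)]
    calc _ ≤ Real.exp (-(2 * Real.exp x)) := by
          apply Real.exp_le_exp.2
          rw [show -1 * -x = x by ring]
          nlinarith [Real.exp_pos x]
      _ ≤ 1 - ‖w‖ := by rwa [hw]
      _ ≤ _ := hn2
  · refine le_trans ?_ hs
    have h5 : Real.exp (-1) ≤ min 1 (Real.exp x) := by
      apply le_min (by linarith)
      apply Real.exp_le_exp.2; linarith
    have h6 : Real.exp (Real.log κ + -1) ≤ κ * min 1 (Real.exp x) := by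
      rw [Real.exp_add, Real.exp_log hκ]; gcongr
    refine le_trans (Real.exp_le_exp.2 ?_) h6
    have h7 : max x 0 ≤ 1 := max_le h.le (by norm_num)
    have h8 : Real.exp (-1) ≤ Real.exp (-1 * |x|) := by
      apply Real.exp_le_exp.2
      have : |x| ≤ 1 := abs_le.2 ⟨h'.le, h.le⟩
      linarith
    have h9 : Real.exp 1 * Real.exp (-1) = 1 := by rw [← Real.exp_add]; simp
    have h10 : 2 + |Real.log κ| ≤ Real.exp 1 * (2 + |Real.log κ|) * Real.exp (-1 * |x|) := by
      calc 2 + |Real.log κ| = Real.exp 1 * (2 + |Real.log κ|) * Real.exp (-1) := by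
            rw [mul_right_comm, h9, one_mul]
        _ ≤ _ := by gcongr
    linarith [neg_abs_le (Real.log κ)]

lemma Lfun {α B κ : ℝ} (hα : 0 < α) (hκ : 0 < κ) {g : ℕ → ℂ} (hg : Function.Injective g)
    {τ : ℕ → ℝ} (hgτ : ∀ k, ‖g k‖ = Real.exp (τ k)) (hτ : ∀ k, |τ k - 1 / (2 * α) * k| ≤ B)
    (hsep : ∀ m n, m ≠ n → κ * min ‖g m‖ ‖g n‖ ≤ ‖g m - g n‖) :
    ∃ (C : ℝ) (L : ℕ → ℂ → ℂ), (∀ n, Differentiable ℂ (L n)) ∧ (∀ n m, L n (g m) = if m = n then 1 else 0) ∧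
      ∀ n z t, ‖z‖ ≤ Real.exp t →
        ‖L n z‖ ≤ Real.exp (C + Sf τ t - max (t - τ n) 0 - Sf τ (τ n)) := by
  have hc : 0 < 1 / (2 * α) := by positivity
  obtain ⟨C1, hC1, hE⟩ := expsum (1 / (2 * α)) 1 B hc one_pos
  set C2 := Real.exp 1 * (2 + |Real.log κ|) with hC2
  have hg0 : ∀ k, g k ≠ 0 := fun k => by rw [← norm_pos_iff, hgτ]; exact Real.exp_pos _
  set a : ℕ → ℕ → ℂ := fun n k => if k = n then 0 else -(g k)⁻¹ with ha
  have hinv : Summable fun k => ‖(g k)⁻¹‖ := by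
    have := (hE τ hτ (-B)).1.mul_left (Real.exp B)
    refine this.congr fun k => ?_
    have h1 := (abs_le.1 (hτ k)).1
    have h2 : 0 ≤ 1 / (2 * α) * k := by positivity
    rw [norm_inv, hgτ, ← Real.exp_neg, ← Real.exp_add, abs_of_nonpos (by linarith)]
    congr 1; ring
  have hasum : ∀ n, Summable fun k => ‖a n k‖ := by
    intro n
    refine Summable.of_nonneg_of_le (fun _ => norm_nonneg _) (fun k => ?_) hinv
    simp only [ha]; split_ifs <;> simp
  choose P hPd hP using fun n => prod_entire (a n) (hasum n)
  have hSf : ∀ (n : ℕ) (t D : ℝ), HasSum (fun k => max (t - τ k) 0 -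
      (if k = n then max (t - τ n) 0 else 0) + D * Real.exp (-1 * |t - τ k|))
      (Sf τ t - max (t - τ n) 0 + D * ∑' k, Real.exp (-1 * |t - τ k|)) := by
    intro n t D
    exact ((Sf_summable hc hτ t).hasSum.sub (hasSum_ite_eq n _)).add ((hE τ hτ t).1.hasSum.mul_left D)
  have hup : ∀ n z t, ‖z‖ ≤ Real.exp t → ‖P n z‖ ≤ Real.exp (Sf τ t - max (t - τ n) 0 + C1) := by
    intro n z t hz
    refine (hasProd_le_exp (hP n z) (hSf n t 1) fun k => ?_).trans ?_
    · simp only [ha]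
      by_cases hk : k = n
      · simp [hk, Real.exp_nonneg]
      · rw [if_neg hk, if_neg hk, sub_zero, one_mul]
        refine le_trans ?_ (one_add_exp_le _)
        refine (norm_add_le _ _).trans ?_
        rw [norm_one, norm_mul, norm_neg, norm_inv, hgτ, ← Real.exp_neg, sub_eq_add_neg, Real.exp_add,
          mul_comm]
        gcongr
    · apply Real.exp_le_exp.2
      have := (hE τ hτ t).2
      linarith
  have hlow : ∀ n, Real.exp (Sf τ (τ n) - C2 * C1) ≤ ‖P n (g n)‖ := by
    intro n
    refine le_trans ?_ (exp_le_hasProd (hP n (g n)) (hSf n (τ n) (-C2)) fun k => ?_)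
    · apply Real.exp_le_exp.2
      have := (hE τ hτ (τ n)).2
      have h2 : 0 ≤ C2 := by positivity
      simp only [sub_self, max_self]
      nlinarith
    · simp only [ha]
      by_cases hk : k = n
      · simp [hk]; positivity
      · rw [if_neg hk, if_neg hk, sub_zero]
        have h1 : ‖g n / g k‖ = Real.exp (τ n - τ k) := by rw [norm_div, hgτ, hgτ, Real.exp_sub]
        have h2 : 1 + -(g k)⁻¹ * g n = 1 - g n / g k := by rw [div_eq_mul_inv]; ring
        rw [h2, neg_mul, ← sub_eq_add_neg]
        apply one_sub_lower hκ h1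
        have h3 : 1 - g n / g k = (g k - g n) / g k := by rw [sub_div, div_self (hg0 k)]
        rw [h3, norm_div, le_div_iff₀ (norm_pos_iff.2 (hg0 k)), ← h1, norm_div, mul_assoc,
          min_mul_of_nonneg _ _ (norm_nonneg _), div_mul_cancel₀ _ (norm_ne_zero_iff.2 (hg0 k)), one_mul]
        exact hsep k n hk
  have hne : ∀ n, P n (g n) ≠ 0 := fun n => by
    rw [← norm_pos_iff]; exact (Real.exp_pos _).trans_le (hlow n)
  refine ⟨C1 + C2 * C1, fun n z => P n z / P n (g n), fun n => (hPd n).div_const _, ?_, ?_⟩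
  · intro n m
    split_ifs with h
    · rw [h]; exact div_self (hne n)
    · have : P n (g m) = 0 := by
        refine (hP n (g m)).unique (hasProd_zero_of_exists_eq_zero ⟨m, ?_⟩)
        simp [ha, h, hg0 m]
      simp [this]
  · intro n z t hz
    rw [norm_div, div_le_iff₀ (norm_pos_iff.2 (hne n))]
    refine (hup n z t hz).trans ?_
    refine le_trans ?_ (mul_le_mul_of_nonneg_left (hlow n) (Real.exp_pos _).le)
    rw [← Real.exp_add]
    apply Real.exp_le_exp.2
    linarith

/-! ## Sufficiency: the interpolation operator -/

lemma annuli_kernel (c ε : ℝ) (hc : 0 < c) (hε : 0 < ε) :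
    ∃ C : ℝ, 0 < C ∧ ∃ W : ℕ → ℂ → ℝ≥0∞, (∀ n, Measurable (W n)) ∧
      (∀ n, ∫⁻ z, W n z ≤ ENNReal.ofReal C) ∧
      ∀ (n : ℕ) (z : ℂ) (m : ℕ), c * m ≤ logPlus ‖z‖ → logPlus ‖z‖ < c * (m + 1) →
        ENNReal.ofReal (Real.exp (-(2 * logPlus ‖z‖) - ε * |(m : ℝ) - n|)) ≤ W n z := by
  obtain ⟨C, hC, hE⟩ := expsum 1 ε 0 one_pos hε
  refine ⟨Real.pi * Real.exp (2 * c) * C, by positivity, fun n z => ∑' j : ℕ,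
    (Metric.ball (0 : ℂ) (Real.exp (c * (j + 1)))).indicator
      (fun _ => ENNReal.ofReal (Real.exp (-(2 * c * j) - ε * |(j : ℝ) - n|))) z, ?_, ?_, ?_⟩
  · intro n
    exact Measurable.tsum fun j => measurable_const.indicator measurableSet_ball
  · intro n
    rw [lintegral_tsum fun j => (measurable_const.indicator measurableSet_ball).aemeasurable]
    have h1 : ∀ j : ℕ, ∫⁻ z, (Metric.ball (0 : ℂ) (Real.exp (c * (j + 1)))).indicator
      (fun _ => ENNReal.ofReal (Real.exp (-(2 * c * j) - ε * |(j : ℝ) - n|))) z =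
      ENNReal.ofReal (Real.pi * Real.exp (2 * c) * Real.exp (-ε * |(n : ℝ) - j|)) := by
      intro j
      rw [lintegral_indicator measurableSet_ball, setLIntegral_const, Complex.volume_ball,
        ← ENNReal.ofReal_pow (by positivity)]
      have : (NNReal.pi : ℝ≥0∞) = ENNReal.ofReal Real.pi := by
        rw [← NNReal.coe_real_pi, ENNReal.ofReal_coe_nnreal]
      rw [this, ← ENNReal.ofReal_mul (by positivity), ← ENNReal.ofReal_mul (by positivity)]
      congr 1
      rw [← Real.exp_nat_mul]
      rw [abs_sub_comm, mul_assoc Real.pi, ← Real.exp_add]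
      have e : -(2 * c * (j : ℝ)) - ε * |(n : ℝ) - j| + ((2 : ℕ) : ℝ) * (c * (j + 1)) =
        2 * c + -ε * |(n : ℝ) - j| := by push_cast; ring
      rw [← e, Real.exp_add]; ring
    simp only [h1]
    obtain ⟨h2, h3⟩ := hE (fun k => (k : ℝ)) (by simp) n
    rw [← ENNReal.ofReal_tsum_of_nonneg (fun j => by positivity) (h2.mul_left _), tsum_mul_left]
    apply ENNReal.ofReal_le_ofReal
    gcongr
  · intro n z m h1 h2
    refine le_trans ?_ (ENNReal.le_tsum m)
    rw [Set.indicator_of_mem]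
    · apply ENNReal.ofReal_le_ofReal
      apply Real.exp_le_exp.2
      linarith
    · rw [mem_ball_zero_iff]
      rcases eq_or_ne z 0 with rfl | hz
      · simpa using Real.exp_pos _
      · rw [← Real.log_lt_iff_lt_exp (norm_pos_iff.2 hz)]
        exact lt_of_le_of_lt (le_max_left _ _) h2

lemma sum_pow_bound {p ε E : ℝ} (hp : 1 ≤ p) (a d : ℕ → ℝ) (ha : ∀ n, 0 ≤ a n)
    (h1 : Summable fun n => Real.exp (-(ε / 2) * d n))
    (h2 : ∑' n, Real.exp (-(ε / 2) * d n) ≤ E)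
    (h3 : Summable fun n => Real.exp (-(p * ε / 2) * d n) * a n ^ p) :
    Summable (fun n => a n * Real.exp (-ε * d n)) ∧
    (∑' n, a n * Real.exp (-ε * d n)) ^ p ≤
      E ^ p * ∑' n, Real.exp (-(p * ε / 2) * d n) * a n ^ p := by
  have hp0 : 0 < p := by linarith
  set Q := ∑' n, Real.exp (-(p * ε / 2) * d n) * a n ^ p with hQ
  have hnn : ∀ n, 0 ≤ Real.exp (-(p * ε / 2) * d n) * a n ^ p := fun n =>
    mul_nonneg (Real.exp_pos _).le (Real.rpow_nonneg (ha n) _)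
  have hQ0 : 0 ≤ Q := tsum_nonneg hnn
  have h4 : ∀ n, a n * Real.exp (-(ε / 2) * d n) ≤ Q ^ (1 / p) := by
    intro n
    have h5 := h3.le_tsum n (fun j _ => hnn j)
    have e : Real.exp (-(p * ε / 2) * d n) * a n ^ p = (a n * Real.exp (-(ε / 2) * d n)) ^ p := by
      rw [Real.mul_rpow (ha n) (Real.exp_pos _).le, ← Real.exp_mul, mul_comm]; ring_nf
    rw [e] at h5
    have := Real.rpow_le_rpow (by have := ha n; positivity) h5 (z := 1 / p) (by positivity)
    rwa [← Real.rpow_mul (by have := ha n; positivity), mul_one_div_cancel hp0.ne', Real.rpow_one] at this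
  have h5 : ∀ n, a n * Real.exp (-ε * d n) ≤ Q ^ (1 / p) * Real.exp (-(ε / 2) * d n) := by
    intro n
    have : Real.exp (-ε * d n) = Real.exp (-(ε / 2) * d n) * Real.exp (-(ε / 2) * d n) := by
      rw [← Real.exp_add]; ring_nf
    rw [this, ← mul_assoc]
    exact mul_le_mul_of_nonneg_right (h4 n) (Real.exp_pos _).le
  have h6 := h1.mul_left (Q ^ (1 / p))
  have h7 : Summable (fun n => a n * Real.exp (-ε * d n)) :=
    Summable.of_nonneg_of_le (fun n => mul_nonneg (ha n) (Real.exp_pos _).le) h5 h6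
  refine ⟨h7, ?_⟩
  have h8 : ∑' n, a n * Real.exp (-ε * d n) ≤ Q ^ (1 / p) * E := by
    refine (h7.tsum_le_tsum h5 h6).trans ?_
    rw [tsum_mul_left]; gcongr
  have hE : 0 ≤ E := (tsum_nonneg fun n => (Real.exp_pos _).le).trans h2
  refine (Real.rpow_le_rpow (tsum_nonneg fun n => mul_nonneg (ha n) (Real.exp_pos _).le) h8
    hp0.le).trans (le_of_eq ?_)
  rw [Real.mul_rpow (by positivity) hE, ← Real.rpow_mul hQ0, one_div_mul_cancel hp0.ne', Real.rpow_one,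
    mul_comm]

/-- the core form of condition (c) -/
def CoreC (α : ℝ) (D : ℕ → ℝ) : Prop :=
  ∃ ε K : ℝ, 0 < ε ∧ ∀ n j : ℕ, ε * j - K ≤ D (n + j) - D n ∧
    D (n + j) - D n ≤ (1 / (2 * α) - ε) * j + K

lemma floor_bounds {α : ℝ} (hα : 0 < α) {t : ℝ} (ht : 0 ≤ t) :
    1 / (2 * α) * (⌊2 * α * t⌋₊ : ℝ) ≤ t ∧ t < 1 / (2 * α) * ((⌊2 * α * t⌋₊ : ℝ) + 1) := by
  have h1 := Nat.floor_le (show 0 ≤ 2 * α * t by positivity)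
  have h2 := Nat.lt_floor_add_one (2 * α * t)
  constructor
  · rw [one_div, inv_mul_le_iff₀ (by positivity)]; exact h1
  · rw [one_div, lt_inv_mul_iff₀ (by positivity)]; exact h2

lemma L_est {α p B κ : ℝ} (hα : 0 < α) (hp : 1 ≤ p) (hκ : 0 < κ) {g : ℕ → ℂ}
    (hg : Function.Injective g)
    {τ : ℕ → ℝ} (hgτ : ∀ k, ‖g k‖ = Real.exp (τ k)) (hτ : ∀ k, |τ k - 1 / (2 * α) * k| ≤ B)
    (hsep : ∀ m n, m ≠ n → κ * min ‖g m‖ ‖g n‖ ≤ ‖g m - g n‖) (hD : CoreC α (Df α p τ)) :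
    ∃ (C ε : ℝ) (L : ℕ → ℂ → ℂ), 0 < ε ∧ (∀ n, Differentiable ℂ (L n)) ∧
      (∀ n m, L n (g m) = if m = n then 1 else 0) ∧
      ∀ n z, ‖L n z‖ ≤ Real.exp (C + phi α z - 2 * logPlus ‖z‖ / p - wt α (τ n) + 2 * τ n / p
        - ε * |(⌊2 * α * logPlus ‖z‖⌋₊ : ℝ) - n|) := by
  obtain ⟨C1, L, hLd, hLg, hL⟩ := Lfun hα hκ hg hgτ hτ hsep
  obtain ⟨ε, K, hε, hDD⟩ := hD
  have hB : 0 ≤ B := (abs_nonneg _).trans (hτ 0)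
  have hc : 0 < 1 / (2 * α) := by positivity
  obtain ⟨C2, hH⟩ := HD α p B (B + 1 / (2 * α)) hα hp
  refine ⟨C1 + 2 * C2 + K + B, ε, L, hε, hLd, hLg, fun n z => ?_⟩
  set t := logPlus ‖z‖ with ht
  have ht0 : 0 ≤ t := le_max_right _ _
  have hzt : ‖z‖ ≤ Real.exp t := by
    rcases eq_or_ne z 0 with rfl | hz
    · simpa using (Real.exp_pos _).le
    · rw [← Real.log_le_iff_le_exp (norm_pos_iff.2 hz)]; exact le_max_left _ _
  refine (hL n z t hzt).trans (Real.exp_le_exp.2 ?_)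
  obtain ⟨f1, f2⟩ := floor_bounds hα ht0
  generalize ⌊2 * α * t⌋₊ = m at f1 f2 ⊢
  have h1 := abs_le.1 (hH τ hτ m t (by rw [abs_le]; constructor <;> linarith))
  have h2 := abs_le.1 (hH τ hτ n (τ n) ((hτ n).trans (by linarith)))
  have h3 := abs_le.1 (hτ n)
  have hphi : phi α z = wt α t := by unfold phi wt; rw [← ht, max_eq_left ht0]
  rw [hphi]
  have hm1 := le_max_left (t - τ n) 0
  have hm2 := le_max_right (t - τ n) 0
  have key : Df α p τ m - Df α p τ n - max (t - τ n) 0 ≤ K + B - ε * |(m : ℝ) - n| := by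
    rcases le_total n m with h | h
    · obtain ⟨j, rfl⟩ := Nat.exists_eq_add_of_le h
      have := (hDD n j).2
      push_cast at *
      rw [show (n : ℝ) + j - n = j by ring, abs_of_nonneg (Nat.cast_nonneg j)]
      nlinarith
    · obtain ⟨j, rfl⟩ := Nat.exists_eq_add_of_le h
      have := (hDD m j).1
      push_cast at *
      rw [show (m : ℝ) - (m + j) = -j by ring, abs_neg, abs_of_nonneg (Nat.cast_nonneg j)]
      linarith
  linarith [h1.1, h1.2, h2.1, h2.2]

lemma interp {α p B κ : ℝ} (hα : 0 < α) (hp : 1 ≤ p) (hκ : 0 < κ) {g : ℕ → ℂ}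
    (hg : Function.Injective g)
    {τ : ℕ → ℝ} (hgτ : ∀ k, ‖g k‖ = Real.exp (τ k)) (hτ : ∀ k, |τ k - 1 / (2 * α) * k| ≤ B)
    (hsep : ∀ m n, m ≠ n → κ * min ‖g m‖ ‖g n‖ ≤ ‖g m - g n‖) (hD : CoreC α (Df α p τ)) :
    ∃ C : ℝ, 0 < C ∧ ∀ v : ℕ → ℂ,
      (∑' n, ENNReal.ofReal ((1 + Real.exp (τ n)) ^ 2 *
        (‖v n‖ * Real.exp (-wt α (τ n))) ^ p)) < ⊤ →
      ∃ f, MemFock α p f ∧ (∀ n, f (g n) = v n) ∧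
        fockNormP α p f ≤ ENNReal.ofReal C * ∑' n, ENNReal.ofReal ((1 + Real.exp (τ n)) ^ 2 *
        (‖v n‖ * Real.exp (-wt α (τ n))) ^ p) := by
  have hp0 : 0 < p := by linarith
  obtain ⟨C1, ε, L, hε, hLd, hLg, hL⟩ := L_est hα hp hκ hg hgτ hτ hsep hD
  obtain ⟨C2, hC2, W, hWm, hWi, hW⟩ := annuli_kernel (1 / (2 * α)) (p * ε / 2) (by positivity)
    (by positivity)
  obtain ⟨E, hE, hsum⟩ := expsum 1 (ε / 2) 0 one_pos (by positivity)
  refine ⟨Real.exp (p * C1) * E ^ p * C2, by positivity, fun v hv => ?_⟩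
  set T := ∑' n, ENNReal.ofReal ((1 + Real.exp (τ n)) ^ 2 *
        (‖v n‖ * Real.exp (-wt α (τ n))) ^ p) with hT
  obtain ⟨a, ha⟩ : ∃ a : ℕ → ℝ, ∀ n, a n = ‖v n‖ * Real.exp (-wt α (τ n) + 2 * τ n / p) :=
    ⟨_, fun n => rfl⟩
  have ha0 : ∀ n, 0 ≤ a n := fun n => by rw [ha]; positivity
  have hap : ∀ n, a n ^ p ≤ (1 + Real.exp (τ n)) ^ 2 * (‖v n‖ * Real.exp (-wt α (τ n))) ^ p := by
    intro n
    rw [ha, Real.exp_add, ← mul_assoc, Real.mul_rpow (by positivity) (by positivity), mul_comm]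
    apply mul_le_mul_of_nonneg_right _ (by positivity)
    rw [← Real.exp_mul, show 2 * τ n / p * p = τ n + τ n by field_simp; ring, Real.exp_add]
    nlinarith [Real.exp_pos (τ n)]
  have hapT : ∑' n, ENNReal.ofReal (a n ^ p) ≤ T :=
    ENNReal.tsum_le_tsum fun n => ENNReal.ofReal_le_ofReal (hap n)
  have hapn : ∀ n, 0 ≤ a n ^ p := fun n => Real.rpow_nonneg (ha0 n) _
  have hsa : Summable fun n => a n ^ p := by
    have := ENNReal.summable_toReal (hapT.trans_lt hv).ne
    simpa only [ENNReal.toReal_ofReal (hapn _)] using this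
  have haT : ∀ n, a n ≤ 1 + T.toReal := by
    intro n
    have h1 : a n ^ p ≤ T.toReal := by
      rw [← ENNReal.ofReal_le_iff_le_toReal hv.ne]
      exact (ENNReal.le_tsum n).trans hapT
    rcases le_total (a n) 1 with h | h
    · have := ENNReal.toReal_nonneg (a := T); linarith
    · have := Real.rpow_le_rpow_of_exponent_le h hp
      rw [Real.rpow_one] at this; linarith
  have hterm : ∀ n z, ‖v n * L n z‖ ≤ Real.exp (C1 + phi α z - 2 * logPlus ‖z‖ / p) *
      (a n * Real.exp (-ε * |(⌊2 * α * logPlus ‖z‖⌋₊ : ℝ) - n|)) := by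
    intro n z
    rw [norm_mul]
    refine (mul_le_mul_of_nonneg_left (hL n z) (norm_nonneg _)).trans (le_of_eq ?_)
    rw [ha, mul_left_comm, mul_assoc, mul_assoc, ← Real.exp_add, mul_left_comm, ← Real.exp_add]
    congr 2
    ring
  have hs1 : ∀ z : ℂ, Summable (fun n : ℕ => Real.exp (-(ε / 2) * |(⌊2 * α * logPlus ‖z‖⌋₊ : ℝ) - n|))
      ∧ ∑' n : ℕ, Real.exp (-(ε / 2) * |(⌊2 * α * logPlus ‖z‖⌋₊ : ℝ) - n|) ≤ E := fun z =>
    hsum (fun k => (k : ℝ)) (by simp) _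
  have hs3 : ∀ z : ℂ, Summable (fun n : ℕ => Real.exp (-(p * ε / 2) *
      |(⌊2 * α * logPlus ‖z‖⌋₊ : ℝ) - n|) * a n ^ p) := by
    intro z
    refine Summable.of_nonneg_of_le (fun n => mul_nonneg (Real.exp_pos _).le (hapn n))
      (fun n => ?_) hsa
    refine mul_le_of_le_one_left (hapn n) (Real.exp_le_one_iff.2 ?_)
    have : 0 ≤ p * ε / 2 * |(⌊2 * α * logPlus ‖z‖⌋₊ : ℝ) - n| := by positivity
    linarith
  have hB := fun z : ℂ => sum_pow_bound hp a (fun n : ℕ => |(⌊2 * α * logPlus ‖z‖⌋₊ : ℝ) - n|) ha0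
    (hs1 z).1 (hs1 z).2 (hs3 z)
  set f : ℂ → ℂ := fun z => ∑' n, v n * L n z with hf
  have hfd : Differentiable ℂ f := by
    intro z0
    set R := ‖z0‖ + 1
    have hR : (1 : ℝ) ≤ R := by have := norm_nonneg z0; simp only [R]; linarith
    have hlR : 0 ≤ Real.log R := Real.log_nonneg hR
    have hd : DifferentiableOn ℂ f (Metric.ball 0 R) := by
      refine differentiableOn_tsum_of_summable_norm
        (u := fun n : ℕ => (1 + T.toReal) * Real.exp (C1 + α * Real.log R ^ 2 + ε * (2 * α * Real.log R)) *
          Real.exp (n * (-ε))) ?_ ?_ Metric.isOpen_ball ?_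
      · exact (Real.summable_exp_nat_mul_iff.2 (by linarith)).mul_left _
      · exact fun n => ((hLd n).const_mul _).differentiableOn
      · intro n w hw
        rw [mem_ball_zero_iff] at hw
        have hl0 : 0 ≤ logPlus ‖w‖ := le_max_right _ _
        have hl : logPlus ‖w‖ ≤ Real.log R := by
          rcases eq_or_ne w 0 with rfl | hw0
          · simpa [logPlus] using hlR
          · exact max_le (Real.log_le_log (norm_pos_iff.2 hw0) hw.le) hlR
        refine (hterm n w).trans ?_
        have h1 : Real.exp (-ε * |(⌊2 * α * logPlus ‖w‖⌋₊ : ℝ) - n|) ≤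
            Real.exp (ε * (2 * α * Real.log R)) * Real.exp (n * (-ε)) := by
          rw [← Real.exp_add]
          apply Real.exp_le_exp.2
          have h2 := Nat.floor_le (show 0 ≤ 2 * α * logPlus ‖w‖ by positivity)
          have h3 := neg_abs_le ((⌊2 * α * logPlus ‖w‖⌋₊ : ℝ) - n)
          have h4 : 2 * α * logPlus ‖w‖ ≤ 2 * α * Real.log R := by gcongr
          nlinarith
        have h5 : Real.exp (C1 + phi α w - 2 * logPlus ‖w‖ / p) ≤
            Real.exp (C1 + α * Real.log R ^ 2) := by
          apply Real.exp_le_exp.2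
          have : 0 ≤ 2 * logPlus ‖w‖ / p := by positivity
          have : phi α w ≤ α * Real.log R ^ 2 := by unfold phi; gcongr
          linarith
        calc _ ≤ Real.exp (C1 + α * Real.log R ^ 2) * ((1 + T.toReal) *
              (Real.exp (ε * (2 * α * Real.log R)) * Real.exp (n * (-ε)))) := by
              have := haT n; have := ha0 n
              gcongr
          _ = _ := by rw [Real.exp_add (C1 + _)]; ring
    exact hd.differentiableAt (Metric.isOpen_ball.mem_nhds (by simp [R]))
  have hnorm : ∀ z, ENNReal.ofReal ((‖f z‖ * Real.exp (-(phi α z))) ^ p) ≤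
      ∑' n, ENNReal.ofReal (Real.exp (p * C1) * E ^ p * a n ^ p) * W n z := by
    intro z
    obtain ⟨b1, b2⟩ := hB z
    have b3 : ‖f z‖ ≤ Real.exp (C1 + phi α z - 2 * logPlus ‖z‖ / p) *
      ∑' n : ℕ, (a n * Real.exp (-ε * |(⌊2 * α * logPlus ‖z‖⌋₊ : ℝ) - n|)) := by
      rw [← tsum_mul_left]
      have hs := b1.mul_left (Real.exp (C1 + phi α z - 2 * logPlus ‖z‖ / p))
      exact tsum_of_norm_bounded hs.hasSum (fun n => hterm n z)
    have b4 : (‖f z‖ * Real.exp (-(phi α z))) ^ p ≤ Real.exp (p * C1 - 2 * logPlus ‖z‖) *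
        (E ^ p * ∑' n : ℕ, Real.exp (-(p * ε / 2) * |(⌊2 * α * logPlus ‖z‖⌋₊ : ℝ) - n|) * a n ^ p) := by
      have h6 : ‖f z‖ * Real.exp (-(phi α z)) ≤ Real.exp (C1 - 2 * logPlus ‖z‖ / p) *
          ∑' n : ℕ, (a n * Real.exp (-ε * |(⌊2 * α * logPlus ‖z‖⌋₊ : ℝ) - n|)) := by
        refine (mul_le_mul_of_nonneg_right b3 (Real.exp_pos _).le).trans (le_of_eq ?_)
        rw [mul_right_comm, ← Real.exp_add]
        congr 2; ring
      refine (Real.rpow_le_rpow (by positivity) h6 hp0.le).trans ?_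
      rw [Real.mul_rpow (by positivity)
        (tsum_nonneg fun n => mul_nonneg (ha0 n) (Real.exp_pos _).le), ← Real.exp_mul,
        show (C1 - 2 * logPlus ‖z‖ / p) * p = p * C1 - 2 * logPlus ‖z‖ by field_simp]
      exact mul_le_mul_of_nonneg_left b2 (Real.exp_pos _).le
    refine (ENNReal.ofReal_le_ofReal b4).trans ?_
    rw [← mul_assoc, ← tsum_mul_left, ENNReal.ofReal_tsum_of_nonneg
      (fun n => by have := hapn n; positivity) ((hs3 z).mul_left _)]
    refine ENNReal.tsum_le_tsum fun n => ?_
    obtain ⟨f1, f2⟩ := floor_bounds hα (show 0 ≤ logPlus ‖z‖ from le_max_right _ _)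
    refine le_trans (le_of_eq ?_) (mul_le_mul_right (hW n z _ f1 f2) _)
    rw [← ENNReal.ofReal_mul (by have := hapn n; positivity)]
    congr 1
    rw [show p * C1 - 2 * logPlus ‖z‖ = p * C1 + (-(2 * logPlus ‖z‖)) by ring,
      Real.exp_add, sub_eq_add_neg (-(2 * logPlus ‖z‖)), Real.exp_add, neg_mul]
    ring
  have hinterp : fockNormP α p f ≤ ENNReal.ofReal (Real.exp (p * C1) * E ^ p * C2) * T := by
    unfold fockNormP
    refine (lintegral_mono hnorm).trans ?_
    rw [lintegral_tsum fun n => ((hWm n).const_mul _).aemeasurable]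
    calc ∑' n, ∫⁻ z, ENNReal.ofReal (Real.exp (p * C1) * E ^ p * a n ^ p) * W n z
        ≤ ∑' n, ENNReal.ofReal (Real.exp (p * C1) * E ^ p * C2) * ENNReal.ofReal (a n ^ p) := by
          refine ENNReal.tsum_le_tsum fun n => ?_
          rw [lintegral_const_mul _ (hWm n)]
          refine (mul_le_mul_right (hWi n) _).trans (le_of_eq ?_)
          rw [← ENNReal.ofReal_mul (by have := hapn n; positivity),
            ← ENNReal.ofReal_mul (by positivity)]
          congr 1; ring
      _ ≤ _ := by
          rw [ENNReal.tsum_mul_left]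
          exact mul_le_mul_right hapT _
  refine ⟨f, ⟨hfd, hinterp.trans_lt (ENNReal.mul_lt_top ENNReal.ofReal_lt_top hv)⟩, fun m => ?_, hinterp⟩
  simp only [hf]
  rw [tsum_eq_single m]
  · simp [hLg]
  · intro n hn; simp [hLg, hn.symm]

/-! ## Uniqueness and sampling -/

lemma dslope_entire {f : ℂ → ℂ} (hf : Differentiable ℂ f) (c : ℂ) :
    Differentiable ℂ (dslope f c) := by
  rw [← differentiableOn_univ] at hf ⊢
  exact (Complex.differentiableOn_dslope Filter.univ_mem).2 hf

lemma entire_factor {f : ℂ → ℂ} (hf : Differentiable ℂ f) {c : ℂ} (hc : f c ≠ 0) :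
    ∃ (k : ℕ) (h : ℂ → ℂ), Differentiable ℂ h ∧ h 0 ≠ 0 ∧ ∀ z, f z = z ^ k * h z := by
  obtain ⟨P, hP⟩ := hf.analyticAt 0
  have hP0 : P ≠ 0 := by
    intro h0
    rw [h0] at hP
    have := hP.eventually_eq_zero
    have h2 := (entire_nhd hf Set.univ).eqOn_zero_of_preconnected_of_eventuallyEq_zero
      isPreconnected_univ (Set.mem_univ 0) this
    exact hc (h2 (Set.mem_univ c))
  refine ⟨P.order, (Function.swap dslope 0)^[P.order] f, ?_,
    hP.iterate_dslope_fslope_ne_zero hP0, fun z => ?_⟩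
  · generalize P.order = k
    induction k with
    | zero => simpa using hf
    | succ k ih =>
      rw [Function.iterate_succ_apply']
      exact dslope_entire ih 0
  · simpa using hP.eq_pow_order_mul_iterate_dslope z

lemma mem_sub {α p : ℝ} (hp : 1 ≤ p) {f g : ℂ → ℂ} (hf : MemFock α p f) (hg : MemFock α p g) :
    MemFock α p (fun z => f z - g z) := by
  refine ⟨hf.1.sub hg.1, ?_⟩
  have hp0 : 0 ≤ p := by linarith
  have h : ∀ z, ENNReal.ofReal ((‖f z - g z‖ * Real.exp (-(phi α z))) ^ p) ≤
      ENNReal.ofReal (2 ^ p) * (ENNReal.ofReal ((‖f z‖ * Real.exp (-(phi α z))) ^ p) +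
        ENNReal.ofReal ((‖g z‖ * Real.exp (-(phi α z))) ^ p)) := by
    intro z
    rw [← ENNReal.ofReal_add (by positivity) (by positivity), ← ENNReal.ofReal_mul (by positivity)]
    apply ENNReal.ofReal_le_ofReal
    set a := ‖f z‖ * Real.exp (-(phi α z))
    set b := ‖g z‖ * Real.exp (-(phi α z))
    have ha : 0 ≤ a := by positivity
    have hb : 0 ≤ b := by positivity
    have hab : ‖f z - g z‖ * Real.exp (-(phi α z)) ≤ a + b := by
      rw [← add_mul]; gcongr; exact norm_sub_le _ _
    refine (Real.rpow_le_rpow (by positivity) hab hp0).trans ?_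
    rcases le_total a b with h | h
    · calc (a + b) ^ p ≤ (2 * b) ^ p := by gcongr; linarith
        _ = 2 ^ p * b ^ p := Real.mul_rpow (by norm_num) hb
        _ ≤ _ := by gcongr; linarith [Real.rpow_nonneg ha p]
    · calc (a + b) ^ p ≤ (2 * a) ^ p := by gcongr; linarith
        _ = 2 ^ p * a ^ p := Real.mul_rpow (by norm_num) ha
        _ ≤ _ := by gcongr; linarith [Real.rpow_nonneg hb p]
  refine (lintegral_mono h).trans_lt ?_
  rw [lintegral_const_mul' _ _ ENNReal.ofReal_ne_top,
    lintegral_add_left (measurable_fockint α p hf.1.continuous)]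
  exact ENNReal.mul_lt_top ENNReal.ofReal_lt_top (ENNReal.add_lt_top.2 ⟨hf.2, hg.2⟩)

lemma uniq {α p B : ℝ} (hα : 0 < α) (hp : 1 ≤ p) {g : ℕ → ℂ}
    (hg : Function.Injective g)
    {τ : ℕ → ℝ} (hgτ : ∀ k, ‖g k‖ = Real.exp (τ k)) (hτ : ∀ k, |τ k - 1 / (2 * α) * k| ≤ B)
    (hD : CoreC α (Df α p τ)) {f : ℂ → ℂ} (hf : MemFock α p f) (hz : ∀ n, f (g n) = 0) :
    ∀ z, f z = 0 := by
  by_contra! hne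
  obtain ⟨c, hc⟩ := hne
  have hp0 : 0 < p := by linarith
  obtain ⟨k, h, hh, h0, hfh⟩ := entire_factor hf.1 hc
  have hhz : ∀ n, h (g n) = 0 := by
    intro n
    have := hz n
    rw [hfh] at this
    rcases mul_eq_zero.1 this with h1 | h1
    · have h2 := hgτ n
      rw [eq_zero_of_pow_eq_zero h1, norm_zero] at h2
      exact absurd h2 (Real.exp_pos _).ne
    · exact h1
  obtain ⟨C1, hC1, hpt⟩ := point_eval' hα hp
  set K := 1 + C1 * (fockNormP α p f).toReal with hK
  have hK1 : 1 ≤ K := by simp only [hK, le_add_iff_nonneg_right]; positivity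
  have hlK : 0 ≤ Real.log K / p := div_nonneg (Real.log_nonneg hK1) hp0.le
  -- upper bound for Sf
  have hS : ∀ t, 0 ≤ t → 2 / (p * α) ≤ t → Sf τ t + Real.log ‖h 0‖ ≤
      Real.log K / p + wt α t - 2 * t / p := by
    intro t ht ht2
    have hwt : wt α t = α * t ^ 2 := by unfold wt; rw [max_eq_left ht]
    have hpos : 0 ≤ Real.log K / p + wt α t - 2 * t / p := by
      have h1 : 2 * t / p ≤ α * t ^ 2 := by
        rw [div_le_iff₀ (by positivity)] at ht2 ⊢
        nlinarith
      linarith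
    have hca : Real.circleAverage (fun z => Real.log ‖h z‖) 0 (Real.exp t) ≤
        Real.log K / p + wt α t - 2 * t / p := by
      apply Real.circleAverage_mono_on_of_le_circle (log_int hh _ _)
      intro z hz'
      rw [abs_of_pos (Real.exp_pos _), mem_sphere_zero_iff_norm] at hz'
      have hb := point_eval_log hα hp (by linarith : 0 < K) (f := f) (z0 := z) (t := t)
        ((hpt f hf z t hz').trans (by linarith))
      have hle : ‖h z‖ ≤ ‖f z‖ := by
        rw [hfh, norm_mul, norm_pow, hz']
        exact le_mul_of_one_le_left (norm_nonneg _) (one_le_pow₀ (Real.one_le_exp ht))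
      rcases eq_or_ne (h z) 0 with h1 | h1
      · simpa [h1] using hpos
      · rw [Real.log_le_iff_le_exp (norm_pos_iff.2 h1)]
        exact hle.trans hb
    have hfin : ∀ N, ∑ i ∈ Finset.range N, max (t - τ i) 0 ≤
        Real.log K / p + wt α t - 2 * t / p - Real.log ‖h 0‖ := by
      intro N
      have := jensen_lower hh h0 (Real.exp_pos t) ((Finset.range N).image g)
        (by simp only [Finset.mem_image]; rintro u ⟨n, -, rfl⟩; exact hhz n)
      rw [Finset.sum_image (fun x _ y _ hxy => hg hxy)] at this
      simp only [zero_sub, norm_neg, hgτ, Real.log_exp] at this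
      linarith
    have := Real.tsum_le_of_sum_range_le (fun i => le_max_right _ _) hfin
    unfold Sf
    linarith
  obtain ⟨C2, hH⟩ := HD α p B 0 hα hp
  obtain ⟨ε, K', hε, hDD⟩ := hD
  set Q := Real.log K / p - Real.log ‖h 0‖ + C2 + K' - Df α p τ 0
  obtain ⟨m, hm⟩ := exists_nat_gt (max (Q / ε) (4 / p))
  have hm1 := (le_max_left _ _).trans_lt hm
  have hm2 := (le_max_right _ _).trans_lt hm
  have h1 := abs_le.1 (hH τ hτ m (1 / (2 * α) * m) (by simp))
  have h2 := hS (1 / (2 * α) * m) (by positivity) (by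
    rw [div_lt_iff₀ hp0] at hm2
    rw [one_div, div_le_iff₀ (by positivity)]
    field_simp
    linarith)
  have h3 := (hDD 0 m).1
  rw [zero_add] at h3
  rw [div_lt_iff₀ hε] at hm1
  simp only [Q] at hm1
  linarith [h1.2, h1.1]

lemma suff {α p B κ : ℝ} (hα : 0 < α) (hp : 1 ≤ p) (hκ : 0 < κ) {g : ℕ → ℂ}
    (hg : Function.Injective g)
    {τ : ℕ → ℝ} (hgτ : ∀ k, ‖g k‖ = Real.exp (τ k)) (hτ : ∀ k, |τ k - 1 / (2 * α) * k| ≤ B)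
    (hsep : ∀ m n, m ≠ n → κ * min ‖g m‖ ‖g n‖ ≤ ‖g m - g n‖) (hD : CoreC α (Df α p τ)) :
    CompleteInterpolating α p (Set.range g) := by
  obtain ⟨C1, hC1, hinterp⟩ := interp hα hp hκ hg hgτ hτ hsep hD
  obtain ⟨C2, hC2, hup⟩ := disc_upper (p := p) hα hp hg hgτ hτ
  have hconv : ∀ v : ℂ → ℂ, (∑' lam : Set.range g, ENNReal.ofReal
      ((1 + ‖(lam : ℂ)‖) ^ 2 * ‖v (lam : ℂ)‖ ^ p *
        Real.exp (-(p * phi α (lam : ℂ))))) = ∑' n, ENNReal.ofReal ((1 + Real.exp (τ n)) ^ 2 *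
        (‖v (g n)‖ * Real.exp (-wt α (τ n))) ^ p) := by
    intro v
    rw [disc_range hg]
    congr 1; funext n
    rw [disc_term (hgτ n) _ (norm_nonneg _)]
  constructor
  · refine ⟨max 1 (max C1 C2), le_max_left _ _, fun f hf => ⟨?_, ?_⟩⟩
    · have h1 := (hup f hf).trans_lt (ENNReal.mul_lt_top ENNReal.ofReal_lt_top hf.2)
      unfold discNormP at h1 ⊢
      rw [hconv] at h1 ⊢
      obtain ⟨F, hF, hFg, hFn⟩ := hinterp _ h1
      have h2 := uniq hα hp hg hgτ hτ hD (mem_sub hp hF hf) (fun n => by rw [hFg]; ring)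
      have h3 : F = f := by funext z; exact sub_eq_zero.1 (h2 z)
      rw [h3] at hFn
      rw [mul_comm, ← div_eq_mul_inv]
      apply ENNReal.div_le_of_le_mul'
      refine hFn.trans ?_
      gcongr
      exact (le_max_left _ _).trans (le_max_right _ _)
    · refine (hup f hf).trans ?_
      gcongr
      exact (le_max_right _ _).trans (le_max_right _ _)
  · intro v hv
    rw [hconv] at hv
    obtain ⟨F, hF, hFg, -⟩ := hinterp _ hv
    refine ⟨F, hF, ?_⟩
    rintro _ ⟨n, rfl⟩
    exact hFg n

/-! ## Necessity: the dual functions -/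

lemma mem_one {α p : ℝ} (hα : 0 < α) (hp : 1 ≤ p) : MemFock α p (fun _ => 1) := by
  refine ⟨differentiable_const _, ?_⟩
  have hp0 : 0 < p := by linarith
  obtain ⟨C, hC, W, hWm, hWi, hW⟩ := annuli_kernel 1 1 one_pos one_pos
  have h : ∀ z, ENNReal.ofReal ((‖(1 : ℂ)‖ * Real.exp (-(phi α z))) ^ p) ≤
      ENNReal.ofReal (Real.exp (9 / (4 * (p * α)))) * W 0 z := by
    intro z
    set l := logPlus ‖z‖ with hl
    have hl0 : 0 ≤ l := le_max_right _ _
    have h1 := Nat.floor_le hl0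
    have h2 := Nat.lt_floor_add_one l
    refine le_trans ?_ (mul_le_mul_right (hW 0 z ⌊l⌋₊ (by simpa using h1) (by simpa using h2)) _)
    rw [← ENNReal.ofReal_mul (Real.exp_pos _).le, ← Real.exp_add, norm_one, one_mul, ← Real.exp_mul]
    apply ENNReal.ofReal_le_ofReal (Real.exp_le_exp.2 _)
    have h3 : (⌊l⌋₊ : ℝ) ≥ 0 := Nat.cast_nonneg _
    rw [Nat.cast_zero, sub_zero, abs_of_nonneg h3, ← hl]
    unfold phi
    rw [← hl]
    have h4 : 3 * l ≤ 9 / (4 * (p * α)) + p * α * l ^ 2 := by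
      have hpa : 0 < p * α := by positivity
      rw [div_add' _ _ _ (by positivity), le_div_iff₀ (by positivity)]
      nlinarith [sq_nonneg (3 - 2 * (p * α) * l)]
    linarith
  refine (lintegral_mono h).trans_lt ?_
  rw [lintegral_const_mul _ (hWm 0)]
  exact ENNReal.mul_lt_top ENNReal.ofReal_lt_top ((hWi 0).trans_lt ENNReal.ofReal_lt_top)

lemma wt_mono {α : ℝ} (hα : 0 < α) {s t : ℝ} (h : s ≤ t) : wt α s ≤ wt α t := by
  unfold wt
  have : max s 0 ≤ max t 0 := max_le_max_right _ h
  have : 0 ≤ max s 0 := le_max_right _ _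
  gcongr

lemma nec_tau {α p : ℝ} (hα : 0 < α) (hp : 1 ≤ p) {g : ℕ → ℂ}
    (hg : Function.Injective g) {τ : ℕ → ℝ} (hgτ : ∀ k, ‖g k‖ = Real.exp (τ k))
    (hS : Sampling α p (Set.range g)) (T : ℝ) : {n | τ n ≤ T}.Finite := by
  obtain ⟨C, hC, h⟩ := hS
  have h1 := (h _ (mem_one hα hp)).2.trans_lt
    (ENNReal.mul_lt_top ENNReal.ofReal_lt_top (mem_one hα hp).2)
  unfold discNormP at h1
  rw [disc_range hg (v := fun _ => 1)] at h1
  have h2 := ENNReal.finite_const_le_of_tsum_ne_top h1.ne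
    (ε := ENNReal.ofReal (Real.exp (-(p * wt α T)))) (by simp [Real.exp_pos])
  refine h2.subset ?_
  intro n hn
  rw [Set.mem_ofPred_eq] at hn ⊢
  apply ENNReal.ofReal_le_ofReal
  rw [phi_eq (hgτ n), norm_one, Real.one_rpow, mul_one]
  have h3 := wt_mono hα hn
  calc Real.exp (-(p * wt α T)) ≤ Real.exp (-(p * wt α (τ n))) := by
        apply Real.exp_le_exp.2; nlinarith
    _ ≤ _ := le_mul_of_one_le_left (Real.exp_pos _).le
        (one_le_pow₀ (by linarith [norm_nonneg (g n)]))

lemma eq_zero_of_punctured {f : ℂ → ℂ} (hf : Continuous f) (c : ℂ) (h : ∀ z, z ≠ c → f z = 0) :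
    ∀ z, f z = 0 := by
  have : f = fun _ => 0 := hf.ext_on (dense_compl_singleton c) continuous_const (fun z hz => h z hz)
  intro z; rw [this]

lemma nec_uniq {α p : ℝ} (hα : 0 < α) (hp : 1 ≤ p) {Λ : Set ℂ} (hS : Sampling α p Λ)
    {f : ℂ → ℂ} (hf : MemFock α p f) (hz : ∀ w ∈ Λ, f w = 0) : ∀ z, f z = 0 := by
  have hp0 : 0 < p := by linarith
  obtain ⟨C, hC, h⟩ := hS
  have h1 := (h f hf).1
  have h2 : discNormP α p Λ f = 0 := by
    unfold discNormP
    rw [ENNReal.tsum_eq_zero]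
    intro w
    rw [hz w w.2]
    simp [hp0.ne']
  rw [h2, nonpos_iff_eq_zero, mul_eq_zero] at h1
  have h3 : fockNormP α p f = 0 := by
    rcases h1 with h1 | h1
    · simp at h1
    · exact h1
  obtain ⟨C1, hC1, hpt⟩ := point_eval' hα hp
  apply eq_zero_of_punctured hf.1.continuous 0
  intro z hz
  have h4 := hpt f hf z (Real.log ‖z‖) (Real.exp_log (norm_pos_iff.2 hz)).symm
  rw [h3, ENNReal.toReal_zero, mul_zero] at h4
  by_contra hne
  have : 0 < ‖f z‖ := norm_pos_iff.2 hne
  have : 0 < (‖f z‖ * Real.exp (-(wt α (Real.log ‖z‖)))) ^ p * Real.exp (2 * Real.log ‖z‖) := by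
    positivity
  linarith

lemma phi_nonneg {α : ℝ} (hα : 0 < α) (z : ℂ) : 0 ≤ phi α z := by unfold phi; positivity

lemma mem_of_le_outside {α p : ℝ} (hα : 0 < α) (hp : 1 ≤ p) {f F : ℂ → ℂ} (hf : MemFock α p f)
    (hF : Differentiable ℂ F) (w : ℂ) (C : ℝ) (hC : 0 ≤ C)
    (h : ∀ z, 1 ≤ ‖z - w‖ → ‖F z‖ ≤ C * ‖f z‖) : MemFock α p F := by
  have hp0 : 0 < p := by linarith
  refine ⟨hF, ?_⟩
  obtain ⟨M, hM⟩ := (isCompact_closedBall w 1).exists_bound_of_continuousOn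
    hF.continuous.continuousOn
  have h1 : ∀ z, ENNReal.ofReal ((‖F z‖ * Real.exp (-(phi α z))) ^ p) ≤
      (Metric.closedBall w 1).indicator (fun _ => ENNReal.ofReal (M ^ p)) z +
      ENNReal.ofReal (C ^ p) * ENNReal.ofReal ((‖f z‖ * Real.exp (-(phi α z))) ^ p) := by
    intro z
    by_cases hz : z ∈ Metric.closedBall w 1
    · rw [Set.indicator_of_mem hz]
      refine le_trans (ENNReal.ofReal_le_ofReal ?_) le_self_add
      apply Real.rpow_le_rpow (by positivity) _ hp0.le
      refine le_trans ?_ (hM z hz)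
      exact mul_le_of_le_one_right (norm_nonneg _)
        (Real.exp_le_one_iff.2 (by linarith [phi_nonneg hα z]))
    · refine le_trans ?_ le_add_self
      rw [← ENNReal.ofReal_mul (by positivity), ← Real.mul_rpow hC (by positivity)]
      apply ENNReal.ofReal_le_ofReal
      apply Real.rpow_le_rpow (by positivity) _ hp0.le
      rw [← mul_assoc]
      gcongr
      apply h
      rw [Metric.mem_closedBall, dist_eq_norm, not_le] at hz
      exact hz.le
  refine (lintegral_mono h1).trans_lt ?_
  rw [lintegral_add_left (measurable_const.indicator measurableSet_closedBall),
    lintegral_const_mul' _ _ ENNReal.ofReal_ne_top,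
    lintegral_indicator measurableSet_closedBall, setLIntegral_const]
  exact ENNReal.add_lt_top.2 ⟨ENNReal.mul_lt_top ENNReal.ofReal_lt_top
    (isCompact_closedBall w 1).measure_lt_top, ENNReal.mul_lt_top ENNReal.ofReal_lt_top hf.2⟩

lemma nec_zeros {α p : ℝ} (hα : 0 < α) (hp : 1 ≤ p) {g : ℕ → ℂ}
    (hS : Sampling α p (Set.range g)) {f : ℂ → ℂ} (hf : MemFock α p f) (n : ℕ)
    (hfg : ∀ m, f (g m) = if m = n then 1 else 0) (w : ℂ) (hw : f w = 0) :
    (∃ m, m ≠ n ∧ g m = w) ∧ deriv f w ≠ 0 := by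
  by_contra hcon
  set h := dslope f w with hh
  have hhd : Differentiable ℂ h := dslope_entire hf.1 w
  have hfac : ∀ z, f z = (z - w) * h z := by
    intro z
    have := sub_smul_dslope f w z
    rw [hw, sub_zero, smul_eq_mul] at this
    exact this.symm
  have hFm : MemFock α p (fun z => (z - g n) * h z) := by
    refine mem_of_le_outside hα hp hf ((differentiable_id.sub_const _).mul hhd) w (1 + ‖w - g n‖)
      (by positivity) ?_
    intro z hz
    rw [hfac, norm_mul, norm_mul, ← mul_assoc]
    gcongr
    calc ‖z - g n‖ = ‖(z - w) + (w - g n)‖ := by ring_nf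
      _ ≤ ‖z - w‖ + ‖w - g n‖ := norm_add_le _ _
      _ ≤ (1 + ‖w - g n‖) * ‖z - w‖ := by nlinarith [norm_nonneg (w - g n)]
  have hF0 := nec_uniq hα hp hS hFm (by
    rintro _ ⟨m, rfl⟩
    by_cases hm : m = n
    · simp [hm]
    · have h1 := hfac (g m)
      rw [hfg, if_neg hm] at h1
      rcases mul_eq_zero.1 h1.symm with h2 | h2
      · have h3 : g m = w := sub_eq_zero.1 h2
        have h4 : deriv f w = 0 := by
          by_contra h5
          exact hcon ⟨⟨m, hm, h3⟩, h5⟩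
        rw [h3, hh, dslope_same, h4, mul_zero]
      · rw [h2, mul_zero])
  have hh0 := eq_zero_of_punctured hhd.continuous (g n) (fun z hz => by
    rcases mul_eq_zero.1 (hF0 z) with h1 | h1
    · exact absurd (sub_eq_zero.1 h1) hz
    · exact h1)
  have h1 := hfg n
  rw [hfac, hh0] at h1
  simp at h1

lemma nec_fun {α p : ℝ} (hα : 0 < α) (hp : 1 ≤ p) {g : ℕ → ℂ}
    (hg : Function.Injective g) {τ : ℕ → ℝ} (hgτ : ∀ k, ‖g k‖ = Real.exp (τ k))
    (hmono : Monotone τ) (hCI : CompleteInterpolating α p (Set.range g)) :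
    ∃ (C : ℝ) (f : ℕ → ℂ → ℂ), (∀ n, Differentiable ℂ (f n)) ∧
      (∀ n m, f n (g m) = if m = n then 1 else 0) ∧
      (∀ n w, f n w = 0 → (∃ m, m ≠ n ∧ g m = w) ∧ deriv (f n) w ≠ 0) ∧
      (∀ n, f n 0 ≠ 0) ∧
      (∀ n, fockNormP α p (f n) ≤ ENNReal.ofReal (Real.exp (C + 2 * τ n - p * wt α (τ n)))) ∧
      (∀ n z t, ‖z‖ = Real.exp t → ‖f n z‖ ≤
        Real.exp (C + wt α t - 2 * t / p + 2 * τ n / p - wt α (τ n))) := by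
  have hp0 : 0 < p := by linarith
  obtain ⟨hS, hI⟩ := hCI
  obtain ⟨C0, hC0, hS0⟩ := hS
  have hS : Sampling α p (Set.range g) := ⟨C0, hC0, hS0⟩
  obtain ⟨C1, hC1, hpt⟩ := point_eval' hα hp
  have key : ∀ n, ∃ f, MemFock α p f ∧ (∀ m, f (g m) = if m = n then 1 else 0) ∧
      fockNormP α p f ≤ ENNReal.ofReal (C0 * ((1 + Real.exp (τ n)) ^ 2 *
        Real.exp (-(p * wt α (τ n))))) := by
    intro n
    have hsum : ∀ v : ℂ → ℂ, (∀ m, v (g m) = if m = n then 1 else 0) →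
        (∑' lam : Set.range g, ENNReal.ofReal
      ((1 + ‖(lam : ℂ)‖) ^ 2 * ‖v (lam : ℂ)‖ ^ p *
        Real.exp (-(p * phi α (lam : ℂ))))) = ENNReal.ofReal ((1 + Real.exp (τ n)) ^ 2 *
        Real.exp (-(p * wt α (τ n)))) := by
      intro v hv
      rw [disc_range hg, tsum_eq_single n]
      · rw [hv, if_pos rfl, norm_one, Real.one_rpow, mul_one, phi_eq (hgτ n), hgτ]
      · intro m hm
        rw [hv, if_neg hm]
        simp [hp0.ne']
    obtain ⟨v, hv⟩ : ∃ v : ℂ → ℂ, ∀ m, v (g m) = if m = n then 1 else 0 :=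
      ⟨fun z => if z = g n then 1 else 0, fun m => by simp [hg.eq_iff]⟩
    obtain ⟨f, hf, hfg⟩ := hI v (by rw [hsum _ hv]; exact ENNReal.ofReal_lt_top)
    have hfg' : ∀ m, f (g m) = if m = n then 1 else 0 := fun m => by
      rw [hfg _ ⟨m, rfl⟩]; exact hv m
    refine ⟨f, hf, hfg', ?_⟩
    have h1 := (hS0 f hf).1
    unfold discNormP at h1
    rw [hsum f hfg', mul_comm, ← div_eq_mul_inv, ENNReal.div_le_iff
      (by simp; linarith) (by simp), ← ENNReal.ofReal_mul (by positivity), mul_comm] at h1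
    exact h1
  choose f hf hfg hfn using key
  have hexp : ∀ n, C0 * ((1 + Real.exp (τ n)) ^ 2 * Real.exp (-(p * wt α (τ n)))) ≤
      Real.exp (Real.log (C0 * (1 + Real.exp (-τ 0)) ^ 2) + 2 * τ n - p * wt α (τ n)) := by
    intro n
    rw [sub_eq_add_neg, Real.exp_add, Real.exp_add, Real.exp_log (by positivity), ← mul_assoc]
    apply mul_le_mul_of_nonneg_right _ (Real.exp_pos _).le
    rw [mul_assoc]
    apply mul_le_mul_of_nonneg_left _ (by linarith)
    rw [two_mul, Real.exp_add, ← pow_two, ← mul_pow, add_mul, ← Real.exp_add, one_mul]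
    apply pow_le_pow_left₀ (by positivity)
    linarith [Real.one_le_exp (show 0 ≤ -τ 0 + τ n by linarith [hmono (Nat.zero_le n)])]
  set K1 := Real.log (C0 * (1 + Real.exp (-τ 0)) ^ 2)
  refine ⟨max K1 ((Real.log C1 + K1) / p), f, fun n => (hf n).1, hfg,
    fun n w hw => nec_zeros hα hp hS (hf n) n (hfg n) w hw, fun n h0 => ?_, fun n => ?_, ?_⟩
  · obtain ⟨⟨m, -, hm⟩, -⟩ := nec_zeros hα hp hS (hf n) n (hfg n) 0 h0
    have := hgτ m
    rw [hm, norm_zero] at this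
    exact absurd this (Real.exp_pos _).ne
  · refine (hfn n).trans (ENNReal.ofReal_le_ofReal ((hexp n).trans (Real.exp_le_exp.2 ?_)))
    linarith [le_max_left K1 ((Real.log C1 + K1) / p)]
  · intro n z t hz
    have h1 := hpt (f n) (hf n) z t hz
    have h2 : (fockNormP α p (f n)).toReal ≤ Real.exp (K1 + 2 * τ n - p * wt α (τ n)) := by
      apply ENNReal.toReal_le_of_le_ofReal (Real.exp_pos _).le
      exact (hfn n).trans (ENNReal.ofReal_le_ofReal (hexp n))
    have h3 := point_eval_log (K := C1 * Real.exp (K1 + 2 * τ n - p * wt α (τ n))) hα hp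
      (by positivity) (h1.trans (by gcongr))
    refine h3.trans (Real.exp_le_exp.2 ?_)
    rw [Real.log_mul hC1.ne' (Real.exp_pos _).ne', Real.log_exp]
    have h4 := le_max_right K1 ((Real.log C1 + K1) / p)
    have h5 : (Real.log C1 + (K1 + 2 * τ n - p * wt α (τ n))) / p =
      (Real.log C1 + K1) / p + 2 * τ n / p - wt α (τ n) := by field_simp; ring
    rw [h5]
    linarith

/-! ## Necessity: circle averages of the dual functions -/

lemma A_sum {g : ℕ → ℂ} (hg : Function.Injective g) {τ : ℕ → ℝ}
    (hgτ : ∀ k, ‖g k‖ = Real.exp (τ k)) (hfin : ∀ T, {n | τ n ≤ T}.Finite) {f : ℂ → ℂ}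
    (hf : Differentiable ℂ f) (h0 : f 0 ≠ 0) (n : ℕ) (hfg : ∀ m, m ≠ n → f (g m) = 0)
    (hz : ∀ w, f w = 0 → (∃ m, m ≠ n ∧ g m = w) ∧ deriv f w ≠ 0) {t T : ℝ} (htT : t ≤ T) :
    Real.circleAverage (fun z => Real.log ‖f z‖) 0 (Real.exp t) =
      ∑ m ∈ (hfin T).toFinset.erase n, max (t - τ m) 0 + Real.log ‖f 0‖ := by
  rw [jensen_exact hf h0 (Real.exp_pos t) (((hfin T).toFinset.erase n).image g)]
  · rw [Finset.sum_image (fun x _ y _ hxy => hg hxy)]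
    simp only [zero_sub, norm_neg, hgτ, Real.log_exp]
  · intro u hu
    rw [Finset.mem_image] at hu
    obtain ⟨m, hm, rfl⟩ := hu
    have h1 := hfg m (Finset.ne_of_mem_erase hm)
    exact ⟨h1, (hz _ h1).2⟩
  · intro u hu hu0
    obtain ⟨⟨m, hm, rfl⟩, -⟩ := hz u hu0
    rw [mem_closedBall_zero_iff, hgτ, Real.exp_le_exp] at hu
    refine Finset.mem_image_of_mem _ (Finset.mem_erase.2 ⟨hm, ?_⟩)
    simp only [Set.Finite.mem_toFinset, Set.mem_ofPred_eq]
    linarith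

lemma Sf_summable' {τ : ℕ → ℝ} (hfin : ∀ T, {n | τ n ≤ T}.Finite) (t : ℝ) :
    Summable fun k => max (t - τ k) 0 := by
  apply summable_of_hasFiniteSupport
  apply (hfin t).subset
  intro k hk
  simp only [Function.mem_support, ne_eq, max_eq_right_iff, not_le] at hk
  simp only [Set.mem_ofPred_eq]
  linarith

lemma Sf_sum {τ : ℕ → ℝ} (hfin : ∀ T, {n | τ n ≤ T}.Finite) {t T : ℝ} (h : t ≤ T) :
    Sf τ t = ∑ m ∈ (hfin T).toFinset, max (t - τ m) 0 := by
  unfold Sf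
  rw [tsum_eq_sum]
  intro b hb
  simp only [Set.Finite.mem_toFinset, Set.mem_ofPred_eq, not_le] at hb
  rw [max_eq_right]; linarith

lemma A_formula {g : ℕ → ℂ} (hg : Function.Injective g) {τ : ℕ → ℝ}
    (hgτ : ∀ k, ‖g k‖ = Real.exp (τ k)) (hfin : ∀ T, {n | τ n ≤ T}.Finite) {f : ℂ → ℂ}
    (hf : Differentiable ℂ f) (h0 : f 0 ≠ 0) (n : ℕ) (hfg : ∀ m, m ≠ n → f (g m) = 0)
    (hz : ∀ w, f w = 0 → (∃ m, m ≠ n ∧ g m = w) ∧ deriv f w ≠ 0) (t : ℝ) :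
    Real.circleAverage (fun z => Real.log ‖f z‖) 0 (Real.exp t) =
      Sf τ t - max (t - τ n) 0 + Real.log ‖f 0‖ := by
  have h1 : t ≤ max t (τ n) := le_max_left _ _
  rw [A_sum hg hgτ hfin hf h0 n hfg hz h1, Sf_sum hfin h1, ← Finset.sum_erase_add _ _
    (show n ∈ (hfin (max t (τ n))).toFinset by simp)]
  ring

lemma circAvg_le {h : ℂ → ℂ} (hh : Differentiable ℂ h) {c : ℂ} (hc : h c ≠ 0) {b : ℂ} {R a : ℝ}
    (hR : 0 < R) (hle : ∀ z ∈ Metric.sphere b R, ‖h z‖ ≤ Real.exp a) :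
    Real.circleAverage (fun z => Real.log ‖h z‖) b R ≤ a := by
  have hpi := Real.two_pi_pos
  have h1 : ∫ θ in 0..2 * Real.pi, Real.log ‖h (circleMap b R θ)‖ ≤
      ∫ θ in 0..2 * Real.pi, a := by
    apply intervalIntegral.integral_mono_ae hpi.le (log_int hh b R) intervalIntegrable_const
    filter_upwards [circ_nonzero_ae hh hc (a := b) hR] with θ hθ
    rw [Real.log_le_iff_le_exp (norm_pos_iff.2 hθ)]
    exact hle _ (circleMap_mem_sphere b hR.le θ)
  rw [Real.circleAverage, smul_eq_mul, inv_mul_le_iff₀ hpi]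
  refine h1.trans (le_of_eq ?_)
  rw [intervalIntegral.integral_const]; simp

lemma lint_xy (G : ℂ → ℝ≥0∞) (hG : Measurable G) :
    ∫⁻ z, G z = ∫⁻ x : ℝ, ∫⁻ y : ℝ, G ((x : ℂ) + y * Complex.I) := by
  rw [← (Complex.volume_preserving_equiv_real_prod.symm).lintegral_comp hG]
  rw [Measure.volume_eq_prod, lintegral_prod _ (by fun_prop)]
  congr 1; funext x; congr 1; funext y
  congr 1
  apply Complex.ext <;> simp [Complex.measurableEquivRealProd]

lemma harnack {f : ℂ → ℂ} (hf : Differentiable ℂ f) {w : ℂ} {τ κ M : ℝ} (hw : ‖w‖ = Real.exp τ)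
    (hfw : ‖f w‖ = 1)
    (hM : ∀ z t, |t - τ| ≤ 12 → ‖z‖ = Real.exp t → ‖f z‖ ≤ Real.exp (M + κ * (t - τ))) :
    ∃ x : ℝ, |x| ≤ 1 ∧ κ * x - 73 * M - 1 ≤
      Real.circleAverage (fun z => Real.log ‖f z‖) 0 (Real.exp (τ + x)) := by
  have hpi := Real.pi_pos
  have hM0 : 0 ≤ M := by
    have := hM w τ (by norm_num) hw
    rw [hfw, sub_self, mul_zero, add_zero] at this
    exact Real.one_le_exp_iff.1 this
  have hw0 : w ≠ 0 := by
    intro h; rw [h, norm_zero] at hw; exact (Real.exp_pos τ).ne hw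
  have hfw0 : f w ≠ 0 := by
    intro h; rw [h, norm_zero] at hfw; exact zero_ne_one hfw
  set ζ0 := Complex.log w with hζ0
  have hζre : ζ0.re = τ := by rw [hζ0, Complex.log_re, hw, Real.log_exp]
  set h : ℂ → ℂ := fun ζ => f (Complex.exp ζ) * Complex.exp (-κ * (ζ - ζ0)) with hh
  have hhd : Differentiable ℂ h := (hf.comp Complex.differentiable_exp).mul (by fun_prop)
  have hhn : ∀ ζ, ‖h ζ‖ = ‖f (Complex.exp ζ)‖ * Real.exp (-κ * (ζ.re - τ)) := by
    intro ζ
    rw [hh]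
    simp only [norm_mul, Complex.norm_exp]
    congr 2
    rw [← hζre]; simp
  have hh0 : ‖h ζ0‖ = 1 := by
    rw [hhn, hζre, sub_self, mul_zero, Real.exp_zero, mul_one, hζ0, Complex.exp_log hw0, hfw]
  have hh0' : h ζ0 ≠ 0 := by
    intro h1; rw [h1, norm_zero] at hh0; exact zero_ne_one hh0
  have hhM : ∀ ζ, |ζ.re - τ| ≤ 12 → ‖h ζ‖ ≤ Real.exp M := by
    intro ζ hζ
    rw [hhn]
    calc _ ≤ Real.exp (M + κ * (ζ.re - τ)) * Real.exp (-κ * (ζ.re - τ)) := by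
          gcongr; exact hM _ _ hζ (Complex.norm_exp _)
      _ = Real.exp M := by rw [← Real.exp_add]; congr 1; ring
  set F : ℂ → ℝ≥0∞ := fun ζ => ENNReal.ofReal (M - Real.log ‖h ζ‖) with hF
  have hFm : Measurable F := ENNReal.measurable_ofReal.comp
    (measurable_const.sub (Real.measurable_log.comp hhd.continuous.norm.measurable))
  have hball : ∫⁻ z in Metric.ball ζ0 12, F z ≤
      ENNReal.ofReal (12 ^ 2 / 2) * ENNReal.ofReal (2 * Real.pi * M) := by
    apply ball_upper F hFm ζ0 12 (by norm_num)
    intro r hr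
    have hci : CircleIntegrable (fun z => M - Real.log ‖h z‖) ζ0 r :=
      (circleIntegrable_const M ζ0 r).sub (log_int hhd ζ0 r)
    rw [circ_avg_eq _ _ _ hci]
    · apply ENNReal.ofReal_le_ofReal
      gcongr
      rw [Real.circleAverage_fun_sub (circleIntegrable_const M ζ0 r) (log_int hhd ζ0 r),
        Real.circleAverage_const]
      have := jensen_ineq hhd hh0' hr.1
      rw [hh0, Real.log_one] at this
      linarith
    · intro θ
      have h1 : ‖h (circleMap ζ0 r θ)‖ ≤ Real.exp M := by
        apply hhM
        rw [← hζre, ← Complex.sub_re]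
        refine (Complex.abs_re_le_norm _).trans ?_
        rw [circleMap_sub_center, norm_circleMap_zero, abs_of_pos hr.1]
        exact hr.2.le
      rcases eq_or_ne (h (circleMap ζ0 r θ)) 0 with h2 | h2
      · rw [h2]; simpa using hM0
      · have := (Real.log_le_iff_le_exp (norm_pos_iff.2 h2)).2 h1
        linarith
  by_contra! hcon
  have hlow : 2 * ENNReal.ofReal (2 * Real.pi * (74 * M + 1)) ≤ ∫⁻ z in Metric.ball ζ0 12, F z := by
    rw [← lintegral_indicator measurableSet_ball, lint_xy _ (hFm.indicator measurableSet_ball)]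
    calc 2 * ENNReal.ofReal (2 * Real.pi * (74 * M + 1))
        = ∫⁻ x in Set.Icc (τ - 1) (τ + 1), ENNReal.ofReal (2 * Real.pi * (74 * M + 1)) := by
          rw [setLIntegral_const, Real.volume_Icc, mul_comm]
          congr 1
          rw [show τ + 1 - (τ - 1) = 2 by ring]; simp
      _ ≤ ∫⁻ x in Set.Icc (τ - 1) (τ + 1), ∫⁻ y : ℝ,
          (Metric.ball ζ0 12).indicator F ((x : ℂ) + y * Complex.I) := by
          refine setLIntegral_mono' measurableSet_Icc fun x hx => ?_
          refine le_trans ?_ (setLIntegral_le_lintegral (Set.Ioc 0 (2 * Real.pi)) _)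
          have hci : CircleIntegrable (fun z => (M + κ * (x - τ)) - Real.log ‖f z‖) 0 (Real.exp x) :=
            (circleIntegrable_const _ _ _).sub (log_int hf _ _)
          have h1 := circ_avg_le _ _ _ hci
          rw [Real.circleAverage_fun_sub (circleIntegrable_const _ _ _) (log_int hf _ _),
            Real.circleAverage_const] at h1
          have h2 := hcon (x - τ) (by rw [abs_le]; constructor <;> linarith [hx.1, hx.2])
          rw [add_sub_cancel] at h2
          refine le_trans (ENNReal.ofReal_le_ofReal ?_) (h1.trans ?_)
          · gcongr; linarith
          · apply lintegral_mono_ae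
            filter_upwards [ae_restrict_mem measurableSet_Ioc,
              ae_restrict_of_ae (circ_nonzero_ae hf hfw0 (a := 0) (Real.exp_pos x))] with y hy hne
            have hmem : (x : ℂ) + y * Complex.I ∈ Metric.ball ζ0 12 := by
              rw [Metric.mem_ball, dist_eq_norm]
              have e1 : ((x : ℂ) + y * Complex.I - ζ0).re = x - τ := by simp [hζre]
              have e2 : ((x : ℂ) + y * Complex.I - ζ0).im = y - w.arg := by
                simp [hζ0, Complex.log_im]
              refine lt_of_le_of_lt (Complex.norm_le_abs_re_add_abs_im _) ?_
              rw [e1, e2]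
              have b1 : |x - τ| ≤ 1 := by rw [abs_le]; constructor <;> linarith [hx.1, hx.2]
              have b2 : |y - w.arg| ≤ 3 * Real.pi := by
                rw [abs_le]
                have := Complex.neg_pi_lt_arg w
                have := Complex.arg_le_pi w
                constructor <;> linarith [hy.1, hy.2]
              have := Real.pi_lt_d2
              linarith
            rw [Set.indicator_of_mem hmem]
            apply ENNReal.ofReal_le_ofReal
            have e3 : Complex.exp ((x : ℂ) + y * Complex.I) = circleMap 0 (Real.exp x) y := by
              rw [circleMap, Complex.exp_add, zero_add, Complex.ofReal_exp]
            rw [hhn, e3, Real.log_mul (norm_ne_zero_iff.2 hne) (Real.exp_pos _).ne', Real.log_exp]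
            simp only [Complex.add_re, Complex.ofReal_re, Complex.mul_re, Complex.I_re, mul_zero,
              Complex.ofReal_im, Complex.I_im, zero_mul, sub_zero, add_zero, mul_one]
            linarith
      _ ≤ _ := setLIntegral_le_lintegral _ _
  have hfinal := hlow.trans hball
  rw [show (2 : ℝ≥0∞) = ENNReal.ofReal 2 by simp, ← ENNReal.ofReal_mul (by norm_num),
    ← ENNReal.ofReal_mul (by norm_num), ENNReal.ofReal_le_ofReal_iff (by positivity)] at hfinal
  nlinarith

/-! ## Necessity: quantitative consequences -/

lemma exp_avg {f : ℂ → ℂ} (hf : Differentiable ℂ f) {c : ℂ} (hc : f c ≠ 0) {R p : ℝ}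
    (hR : 0 < R) :
    ENNReal.ofReal (2 * Real.pi * Real.exp (p * Real.circleAverage (fun z => Real.log ‖f z‖) 0 R)) ≤
      ∫⁻ θ in Set.Ioc 0 (2 * Real.pi), ENNReal.ofReal (‖f (circleMap 0 R θ)‖ ^ p) := by
  set A := Real.circleAverage (fun z => Real.log ‖f z‖) 0 R with hA
  have h1 : CircleIntegrable (fun z => (Real.exp (p * A) * p) • Real.log ‖f z‖) 0 R :=
    (log_int hf 0 R).const_smul
  have h2 : CircleIntegrable (fun _ : ℂ => Real.exp (p * A) * (1 - p * A)) 0 R :=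
    circleIntegrable_const _ _ _
  have h3 := circ_avg_le _ _ _ (h1.add h2)
  rw [Real.circleAverage_add h1 h2, Real.circleAverage_const, Real.circleAverage_fun_smul, ← hA,
    smul_eq_mul, show Real.exp (p * A) * p * A + Real.exp (p * A) * (1 - p * A) =
      Real.exp (p * A) by ring] at h3
  refine h3.trans (lintegral_mono_ae ?_)
  filter_upwards [ae_restrict_of_ae (circ_nonzero_ae hf hc (a := 0) hR)] with θ hθ
  apply ENNReal.ofReal_le_ofReal
  simp only [Pi.add_apply, smul_eq_mul]
  have hpos := norm_pos_iff.2 hθ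
  rw [Real.rpow_def_of_pos hpos]
  set l := Real.log ‖f (circleMap 0 R θ)‖
  have h4 := Real.add_one_le_exp (p * (l - A))
  have h5 : Real.exp (l * p) = Real.exp (p * A) * Real.exp (p * (l - A)) := by
    rw [← Real.exp_add]; ring_nf
  rw [h5]
  have := mul_le_mul_of_nonneg_left h4 (Real.exp_pos (p * A)).le
  linarith

lemma loc_bound {α p C τ t : ℝ} (hα : 0 < α) (hp : 1 ≤ p) (ht : |t - τ| ≤ 12) :
    C + wt α t - 2 * t / p + 2 * τ / p - wt α τ ≤
      (C + 144 * α + 24) + 2 * α * max τ 0 * (t - τ) := by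
  have h1 := wt_upper hα t τ
  have h2 : (t - τ) ^ 2 ≤ 144 := by
    have := abs_le.1 ht
    nlinarith
  have h3 : -(2 * t / p) + 2 * τ / p ≤ 24 := by
    have : -(2 * t / p) + 2 * τ / p = 2 * (τ - t) / p := by ring
    rw [this, div_le_iff₀ (by linarith)]
    have := abs_le.1 ht
    linarith
  nlinarith

lemma sep_one {f : ℂ → ℂ} (hf : Differentiable ℂ f) {w w' : ℂ} {τ κ M : ℝ}
    (hw : ‖w‖ = Real.exp τ) (hfw : ‖f w‖ = 1) (hfw' : f w' = 0)
    (hM : ∀ z t, |t - τ| ≤ 12 → ‖z‖ = Real.exp t → ‖f z‖ ≤ Real.exp (M + κ * (t - τ))) :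
    1 / (2 * Real.exp M + 2) * ‖w‖ ≤ ‖w' - w‖ := by
  have hM1 := Real.exp_pos M
  have hw0 : w ≠ 0 := by
    intro h; rw [h, norm_zero] at hw; exact (Real.exp_pos τ).ne hw
  have hwpos := norm_pos_iff.2 hw0
  by_contra! hcon
  set x := w' / w - 1 with hx
  have hxn : ‖x‖ = ‖w' - w‖ / ‖w‖ := by
    rw [hx, ← norm_div]; congr 1; field_simp
  have hx1 : ‖x‖ < 1 / (2 * Real.exp M + 2) := by
    rw [hxn, div_lt_iff₀ hwpos]; exact hcon
  have hx2 : ‖x‖ ≤ 1 / 2 := by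
    refine hx1.le.trans ?_
    apply one_div_le_one_div_of_le (by norm_num); linarith
  have hlog := Complex.norm_log_one_add_half_le_self hx2
  set ζ0 := Complex.log w with hζ0
  have hζre : ζ0.re = τ := by rw [hζ0, Complex.log_re, hw, Real.log_exp]
  set h : ℂ → ℂ := fun ζ => f (Complex.exp ζ) * Complex.exp (-κ * (ζ - ζ0)) with hh
  have hhd : Differentiable ℂ h := (hf.comp Complex.differentiable_exp).mul (by fun_prop)
  have hhn : ∀ ζ, ‖h ζ‖ = ‖f (Complex.exp ζ)‖ * Real.exp (-κ * (ζ.re - τ)) := by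
    intro ζ
    rw [hh]
    simp only [norm_mul, Complex.norm_exp]
    congr 2
    rw [← hζre]; simp
  have hh0 : ‖h ζ0‖ = 1 := by
    rw [hhn, hζre, sub_self, mul_zero, Real.exp_zero, mul_one, hζ0, Complex.exp_log hw0, hfw]
  have hhM : ∀ ζ, |ζ.re - τ| ≤ 12 → ‖h ζ‖ ≤ Real.exp M := by
    intro ζ hζ
    rw [hhn]
    calc _ ≤ Real.exp (M + κ * (ζ.re - τ)) * Real.exp (-κ * (ζ.re - τ)) := by
          gcongr; exact hM _ _ hζ (Complex.norm_exp _)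
      _ = Real.exp M := by rw [← Real.exp_add]; congr 1; ring
  have h1x : 1 + x ≠ 0 := by
    intro h0
    have : x = -1 := by linear_combination h0
    rw [this, norm_neg, norm_one] at hx2; norm_num at hx2
  have hz : h (ζ0 + Complex.log (1 + x)) = 0 := by
    rw [hh]
    simp only
    rw [Complex.exp_add, Complex.exp_log hw0, Complex.exp_log h1x,
      show w * (1 + x) = w' by rw [hx]; field_simp; ring, hfw', zero_mul]
  have hmaps : Set.MapsTo h (Metric.ball ζ0 12) (Metric.ball (h ζ0) (2 * Real.exp M + 1)) := by
    intro ζ hζ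
    rw [Metric.mem_ball, dist_eq_norm] at hζ ⊢
    have h1 := hhM ζ (by
      rw [← hζre, ← Complex.sub_re]
      exact (Complex.abs_re_le_norm _).trans hζ.le)
    have h2 := norm_sub_le (h ζ) (h ζ0)
    rw [hh0] at h2
    linarith
  have hb : ζ0 + Complex.log (1 + x) ∈ Metric.ball ζ0 12 := by
    rw [Metric.mem_ball, dist_eq_norm, add_sub_cancel_left]; linarith
  have hs := Complex.dist_le_div_mul_dist_of_mapsTo_ball hhd.differentiableOn
    (hmaps.mono_right Metric.ball_subset_closedBall) hb
  rw [hz, dist_zero_left, hh0, dist_eq_norm, add_sub_cancel_left] at hs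
  have h3 : (2 * Real.exp M + 2) * ‖x‖ < 1 := by
    rw [lt_div_iff₀ (by positivity)] at hx1; linarith
  have h4 : (2 * Real.exp M + 1) / 12 * ‖Complex.log (1 + x)‖ ≤
      (2 * Real.exp M + 1) / 12 * (3 / 2 * ‖x‖) := by gcongr
  nlinarith [norm_nonneg x]

lemma nec_pack {α p : ℝ} (hα : 0 < α) (hp : 1 ≤ p) {g : ℕ → ℂ}
    (hg : Function.Injective g) {τ : ℕ → ℝ} (hgτ : ∀ k, ‖g k‖ = Real.exp (τ k))
    (hmono : Monotone τ) (hCI : CompleteInterpolating α p (Set.range g)) :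
    ∃ (C κ : ℝ) (a : ℕ → ℝ), 0 < κ ∧
      (∀ m n, m ≠ n → κ * ‖g n‖ ≤ ‖g m - g n‖) ∧
      (∀ n, -C ≤ Sf τ (τ n) + a n) ∧
      (∀ n t, Sf τ t - max (t - τ n) 0 + a n ≤
        C + wt α t - 2 * t / p + 2 * τ n / p - wt α (τ n)) ∧
      (∀ n, ∫⁻ r in Set.Ioi (0 : ℝ), ENNReal.ofReal (2 * Real.pi * r *
        Real.exp (p * (Sf τ (Real.log r) - max (Real.log r - τ n) 0 + a n - wt α (Real.log r)))) ≤
        ENNReal.ofReal (Real.exp (C + 2 * τ n - p * wt α (τ n)))) := by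
  have hp0 : 0 < p := by linarith
  obtain ⟨C, f, hfd, hfg, hfz, hf0, hfn, hfb⟩ := nec_fun hα hp hg hgτ hmono hCI
  have hfin := nec_tau hα hp hg hgτ hCI.1
  set M := C + 144 * α + 24 with hM
  have hloc : ∀ n z t, |t - τ n| ≤ 12 → ‖z‖ = Real.exp t →
      ‖f n z‖ ≤ Real.exp (M + 2 * α * max (τ n) 0 * (t - τ n)) := fun n z t ht hz =>
    (hfb n z t hz).trans (Real.exp_le_exp.2 (loc_bound hα hp ht))
  have hnn : ∀ n, ‖f n (g n)‖ = 1 := fun n => by rw [hfg]; simp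
  have hzz : ∀ n m, m ≠ n → f n (g m) = 0 := fun n m hm => by rw [hfg, if_neg hm]
  have hAf := fun n => A_formula hg hgτ hfin (hfd n) (hf0 n) n (hzz n) (hfz n)
  have hAs := fun n => fun (t T : ℝ) (htT : t ≤ T) =>
    A_sum hg hgτ hfin (hfd n) (hf0 n) n (hzz n) (hfz n) htT
  have hM0 : 0 ≤ M := by
    have := hloc 0 (g 0) (τ 0) (by norm_num) (hgτ 0)
    rw [hnn, sub_self, mul_zero, add_zero] at this
    exact Real.one_le_exp_iff.1 this
  refine ⟨max C (150 * M + 2), 1 / (2 * Real.exp M + 2), fun n => Real.log ‖f n 0‖,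
    by positivity, fun m n hmn => ?_, fun n => ?_, fun n t => ?_, fun n => ?_⟩
  · exact sep_one (hfd n) (hgτ n) (hnn n) (hzz n m hmn) (hloc n)
  · obtain ⟨x, hx, hxA⟩ := harnack (hfd n) (hgτ n) (hnn n) (hloc n)
    set κ := 2 * α * max (τ n) 0
    have hup : ∀ s : ℝ, |s| ≤ 12 →
        Real.circleAverage (fun z => Real.log ‖f n z‖) 0 (Real.exp (τ n + s)) ≤ M + κ * s := by
      intro s hs
      apply circAvg_le (hfd n) (hf0 n) (Real.exp_pos _)
      intro z hz
      rw [mem_sphere_zero_iff_norm] at hz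
      have := hloc n z (τ n + s) (by simpa using hs) hz
      simpa using this
    have hA0 := hAs n (τ n) (τ n + 2) (by linarith)
    have hAF := hAf n (τ n)
    rw [sub_self, max_self, sub_zero] at hAF
    rw [← hAF]
    set S := (hfin (τ n + 2)).toFinset.erase n
    -- convexity
    have conv : ∀ s l : ℝ, 0 ≤ l → l ≤ 1 → |s| ≤ 2 →
        Real.circleAverage (fun z => Real.log ‖f n z‖) 0 (Real.exp (τ n + l * s)) ≤
        (1 - l) * Real.circleAverage (fun z => Real.log ‖f n z‖) 0 (Real.exp (τ n)) +
        l * Real.circleAverage (fun z => Real.log ‖f n z‖) 0 (Real.exp (τ n + s)) := by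
      intro s l hl0 hl1 hs
      have hs' := abs_le.1 hs
      rw [hA0, hAs n (τ n + l * s) (τ n + 2) (by nlinarith), hAs n (τ n + s) (τ n + 2) (by linarith)]
      have h1 : ∑ m ∈ S, max (τ n + l * s - τ m) 0 ≤
          ∑ m ∈ S, ((1 - l) * max (τ n - τ m) 0 + l * max (τ n + s - τ m) 0) := by
        apply Finset.sum_le_sum
        intro m _
        apply max_le
        · have := le_max_left (τ n - τ m) 0
          have := le_max_left (τ n + s - τ m) 0
          nlinarith
        · have := le_max_right (τ n - τ m) 0
          have := le_max_right (τ n + s - τ m) 0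
          have : 0 ≤ 1 - l := by linarith
          positivity
      rw [Finset.sum_add_distrib, ← Finset.mul_sum, ← Finset.mul_sum] at h1
      linarith
    set A := Real.circleAverage (fun z => Real.log ‖f n z‖) 0 (Real.exp (τ n))
    refine le_trans (neg_le_neg (le_max_right _ _)) ?_
    have hx' := abs_le.1 hx
    rcases le_total 0 x with h0 | h0
    · have h1 := conv 2 (x / 2) (by linarith) (by linarith) (by norm_num)
      have h2 := hup 2 (by norm_num)
      rw [show τ n + x / 2 * 2 = τ n + x by ring] at h1
      have h3 := mul_le_mul_of_nonneg_left h2 (show 0 ≤ x / 2 by linarith)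
      by_contra! h4
      nlinarith
    · have h1 := conv (-2) (-x / 2) (by linarith) (by linarith) (by norm_num)
      have h2 := hup (-2) (by norm_num)
      rw [show τ n + -x / 2 * -2 = τ n + x by ring] at h1
      have h3 := mul_le_mul_of_nonneg_left h2 (show 0 ≤ -x / 2 by linarith)
      by_contra! h4
      nlinarith
  · rw [← hAf n t]
    refine le_trans (circAvg_le (a := C + wt α t - 2 * t / p + 2 * τ n / p - wt α (τ n))
      (hfd n) (hf0 n) (Real.exp_pos _) (fun z hz => ?_)) ?_
    · rw [mem_sphere_zero_iff_norm] at hz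
      exact hfb n z t hz
    · linarith [le_max_left C (150 * M + 2)]
  · refine le_trans ?_ ((hfn n).trans (ENNReal.ofReal_le_ofReal (Real.exp_le_exp.2
      (by linarith [le_max_left C (150 * M + 2)]))))
    unfold fockNormP
    rw [polar_circ _ (measurable_fockint α p (hfd n).continuous) 0]
    refine setLIntegral_mono' measurableSet_Ioi fun r hr => ?_
    rw [Set.mem_Ioi] at hr
    have h1 := exp_avg (p := p) (hfd n) (hf0 n) hr
    have h2 := hAf n (Real.log r)
    rw [Real.exp_log hr] at h2
    rw [h2] at h1
    have h3 : ∀ θ, ENNReal.ofReal ((‖f n (circleMap 0 r θ)‖ *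
        Real.exp (-(phi α (circleMap 0 r θ)))) ^ p) =
        ENNReal.ofReal (Real.exp (-(p * wt α (Real.log r)))) *
          ENNReal.ofReal (‖f n (circleMap 0 r θ)‖ ^ p) := by
      intro θ
      rw [← ENNReal.ofReal_mul (Real.exp_pos _).le, phi_eq (t := Real.log r)
        (by rw [norm_circleMap_zero, abs_of_pos hr, Real.exp_log hr]),
        Real.mul_rpow (norm_nonneg _) (Real.exp_pos _).le, ← Real.exp_mul, mul_comm]
      congr 3; ring
    simp only [h3]
    rw [lintegral_const_mul' _ _ ENNReal.ofReal_ne_top]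
    refine le_trans (le_of_eq ?_) (mul_le_mul_right (mul_le_mul_right h1 _) _)
    rw [← ENNReal.ofReal_mul (Real.exp_pos _).le, ← ENNReal.ofReal_mul hr.le]
    congr 1
    rw [mul_sub p _ (wt α _), sub_eq_add_neg, Real.exp_add]
    ring

lemma nec_bdd {α p C : ℝ} (hα : 0 < α) (hp : 1 ≤ p) {τ : ℕ → ℝ} (hmono : Monotone τ)
    (hfin : ∀ T, {n | τ n ≤ T}.Finite)
    (h : ∀ n t, Sf τ t - wt α t + 2 * t / p ≤
      Sf τ (τ n) - wt α (τ n) + 2 * τ n / p + max (t - τ n) 0 + C) :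
    ∃ B, ∀ n, |τ n - 1 / (2 * α) * n| ≤ B := by
  have hp0 : 0 < p := by linarith
  have hp1 : 0 < 2 / p := by positivity
  have hp2 : 2 / p ≤ 2 := by rw [div_le_iff₀ hp0]; linarith
  have hcard : ∀ n : ℕ, ∀ F : Finset ℕ, (∀ m, m < n → m ∈ F) →
      ∑ m ∈ F, (if m < n then (1 : ℝ) else 0) = n := by
    intro n F hF
    rw [← Finset.sum_filter]
    have : F.filter (fun m => m < n) = Finset.range n := by
      ext m; simp only [Finset.mem_filter, Finset.mem_range]
      exact ⟨fun h => h.2, fun h => ⟨hF m h, h⟩⟩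
    rw [this]; simp
  have key : ∀ n : ℕ, |2 * α * max (τ n) 0 - n| ≤ C + α + 2 := by
    intro n
    have e1 := Sf_sum hfin (le_refl (τ n + 1))
    have e2 := Sf_sum hfin (show τ n ≤ τ n + 1 by linarith)
    have e3 := Sf_sum hfin (show τ n - 1 ≤ τ n + 1 by linarith)
    have u1 : Sf τ (τ n) + (n + 1 : ℕ) ≤ Sf τ (τ n + 1) := by
      rw [e1, e2, ← hcard (n + 1) (hfin (τ n + 1)).toFinset (fun m hm => by
        simp only [Set.Finite.mem_toFinset, Set.mem_ofPred_eq]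
        linarith [hmono (Nat.lt_succ_iff.1 hm)]), ← Finset.sum_add_distrib]
      refine Finset.sum_le_sum fun m _ => ?_
      split_ifs with hm
      · have := hmono (Nat.lt_succ_iff.1 hm)
        rw [max_eq_left (by linarith), max_eq_left (by linarith)]; linarith
      · rw [add_zero]
        exact max_le_max (by linarith) le_rfl
    have u2 : Sf τ (τ n) ≤ Sf τ (τ n - 1) + n := by
      rw [e3, e2, ← hcard n (hfin (τ n + 1)).toFinset (fun m hm => by
        simp only [Set.Finite.mem_toFinset, Set.mem_ofPred_eq]
        linarith [hmono hm.le]), ← Finset.sum_add_distrib]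
      refine Finset.sum_le_sum fun m _ => ?_
      split_ifs with hm
      · apply max_le
        · linarith [le_max_left (τ n - 1 - τ m) 0]
        · linarith [le_max_right (τ n - 1 - τ m) 0]
      · have := hmono (not_lt.1 hm)
        rw [max_eq_right (by linarith)]
        linarith [le_max_right (τ n - 1 - τ m) 0]
    have h1 := h n (τ n + 1)
    have h2 := h n (τ n - 1)
    rw [max_eq_left (by linarith)] at h1
    rw [max_eq_right (by linarith)] at h2
    have w1 := wt_upper hα (τ n + 1) (τ n)
    have w2 := wt_upper hα (τ n - 1) (τ n)
    rw [show 2 * (τ n + 1) / p = 2 * τ n / p + 2 / p by ring] at h1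
    rw [show 2 * (τ n - 1) / p = 2 * τ n / p - 2 / p by ring] at h2
    push_cast at u1
    rw [show τ n + 1 - τ n = 1 by ring] at h1 w1
    rw [show τ n - 1 - τ n = -1 by ring] at w2
    rw [abs_le]
    constructor <;> nlinarith
  refine ⟨(C + α + 2) / (2 * α) + |τ 0|, fun n => ?_⟩
  have h0 := hmono (Nat.zero_le n)
  have h1 : |max (τ n) 0 - τ n| ≤ |τ 0| := by
    rcases le_total (τ n) 0 with h2 | h2
    · rw [max_eq_right h2, zero_sub, abs_neg, abs_of_nonpos h2, abs_of_nonpos (h0.trans h2)]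
      linarith
    · rw [max_eq_left h2, sub_self, abs_zero]; exact abs_nonneg _
  have h2 : |max (τ n) 0 - 1 / (2 * α) * n| ≤ (C + α + 2) / (2 * α) := by
    rw [le_div_iff₀ (by positivity), ← abs_of_pos (show 0 < 2 * α by positivity), ← abs_mul,
      abs_of_pos (show 0 < 2 * α by positivity)]
    refine le_trans (le_of_eq ?_) (key n)
    congr 1; field_simp
  rw [abs_le] at *
  constructor <;> linarith [h1.1, h1.2, h2.1, h2.2]

lemma nec_bdd' {α p C : ℝ} {a : ℕ → ℝ} {τ : ℕ → ℝ}
    (h1 : ∀ n, -C ≤ Sf τ (τ n) + a n)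
    (h2 : ∀ n t, Sf τ t - max (t - τ n) 0 + a n ≤
        C + wt α t - 2 * t / p + 2 * τ n / p - wt α (τ n)) (n : ℕ) (t : ℝ) :
    Sf τ t - wt α t + 2 * t / p ≤
      Sf τ (τ n) - wt α (τ n) + 2 * τ n / p + max (t - τ n) 0 + 2 * C := by
  linarith [h1 n, h2 n t]

lemma nec_sum {α p B C : ℝ} (hα : 0 < α) (hp : 1 ≤ p) {τ a : ℕ → ℝ}
    (hτ : ∀ n, |τ n - 1 / (2 * α) * n| ≤ B)
    (h1 : ∀ n, -C ≤ Sf τ (τ n) + a n)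
    (h3 : ∀ n, ∫⁻ r in Set.Ioi (0 : ℝ), ENNReal.ofReal (2 * Real.pi * r *
        Real.exp (p * (Sf τ (Real.log r) - max (Real.log r - τ n) 0 + a n - wt α (Real.log r)))) ≤
        ENNReal.ofReal (Real.exp (C + 2 * τ n - p * wt α (τ n)))) :
    ∃ E, ∀ (n : ℕ) (S : Finset ℕ), ∑ m ∈ S, Real.exp (p * (Df α p τ m - Df α p τ n -
      max (((m : ℝ) - n) * (1 / (2 * α))) 0)) ≤ E := by
  have hp0 : 0 < p := by linarith
  set c := 1 / (2 * α) with hc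
  have hc0 : 0 < c := by positivity
  have hB : 0 ≤ B := (abs_nonneg _).trans (hτ 0)
  obtain ⟨C1, hC1⟩ := HD α p B (B + c) hα hp
  specialize hC1 τ hτ
  set C2 := 2 * C1 + C + c + B with hC2
  set Q := 2 * Real.pi * (1 - Real.exp (-c)) with hQ
  have hQ0 : 0 < Q := by
    have := Real.pi_pos
    have : Real.exp (-c) < 1 := by
      rw [← Real.exp_zero]; exact Real.exp_lt_exp.2 (by linarith)
    apply mul_pos (by linarith); linarith
  refine ⟨Real.exp (C + p * C2) / Q, fun n S => ?_⟩
  set x : ℕ → ℝ := fun m => Real.exp (p * (Df α p τ m - Df α p τ n -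
      max (((m : ℝ) - n) * c) 0)) with hx
  set G := Real.exp (2 * τ n - p * wt α (τ n)) with hG
  set I : ℕ → Set ℝ := fun m => Set.Ico (Real.exp (c * m)) (Real.exp (c * (m + 1 : ℕ))) with hI
  set W : ℝ → ℝ≥0∞ := fun r => ENNReal.ofReal (2 * Real.pi * r *
        Real.exp (p * (Sf τ (Real.log r) - max (Real.log r - τ n) 0 + a n - wt α (Real.log r))))
    with hW
  have hdisj : Pairwise (Function.onFun Disjoint I) := by
    have hm : Monotone fun m : ℕ => Real.exp (c * m) := fun i j hij => by
      apply Real.exp_le_exp.2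
      have : (i : ℝ) ≤ j := by exact_mod_cast hij
      nlinarith
    exact hm.pairwise_disjoint_on_Ico_succ
  have hone : ∀ m, ENNReal.ofReal (Q * Real.exp (-(p * C2)) * G * x m) ≤ ∫⁻ r in I m, W r := by
    intro m
    have hlow : ∀ r ∈ I m, ENNReal.ofReal (2 * Real.pi * Real.exp (-(c * (m + 1 : ℕ))) *
        Real.exp (-(p * C2)) * G * x m) ≤ W r := by
      intro r hr
      have hr0 : 0 < r := (Real.exp_pos _).trans_le hr.1
      set t := Real.log r with ht
      have hrt : r = Real.exp t := (Real.exp_log hr0).symm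
      have t1 : c * m ≤ t := by
        have := hr.1; rw [hrt] at this; exact Real.exp_le_exp.1 this
      have t2 : t < c * (m + 1 : ℕ) := by
        have := hr.2; rw [hrt] at this; exact Real.exp_lt_exp.1 this
      have t3 := t2
      push_cast at t3
      have d1 := (abs_le.1 (hC1 m t (by rw [abs_le]; constructor <;> linarith))).1
      have d2 := (abs_le.1 (hC1 n (τ n) ((hτ n).trans (by linarith)))).2
      have d3 := h1 n
      have d4 : max (t - τ n) 0 ≤ max (((m : ℝ) - n) * c) 0 + c + B := by
        have := (abs_le.1 (hτ n)).1
        apply max_le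
        · have := le_max_left (((m : ℝ) - n) * c) 0
          nlinarith
        · have := le_max_right (((m : ℝ) - n) * c) 0
          linarith
      apply ENNReal.ofReal_le_ofReal
      rw [hrt, hG, hx]
      simp only [mul_assoc, ← Real.exp_add, Real.log_exp]
      apply mul_le_mul_of_nonneg_left _ (by norm_num)
      apply mul_le_mul_of_nonneg_left _ Real.pi_pos.le
      apply Real.exp_le_exp.2
      have d5 : Df α p τ m - Df α p τ n - max (((m : ℝ) - n) * c) 0 - C2 - 2 * t / p + 2 * τ n / p
          - wt α (τ n) ≤ Sf τ t - max (t - τ n) 0 + a n - wt α t := by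
        linarith
      have d6 := mul_le_mul_of_nonneg_left d5 hp0.le
      have d7 : p * (Df α p τ m - Df α p τ n - max (((m : ℝ) - n) * c) 0 - C2 - 2 * t / p +
          2 * τ n / p - wt α (τ n)) = p * (Df α p τ m - Df α p τ n - max (((m : ℝ) - n) * c) 0)
          - p * C2 - 2 * t + 2 * τ n - p * wt α (τ n) := by
        field_simp
      rw [d7] at d6
      linarith
    refine le_trans ?_ (setLIntegral_mono' measurableSet_Ico hlow)
    rw [lintegral_const, Measure.restrict_apply MeasurableSet.univ, Set.univ_inter,
      Real.volume_Ico, ← ENNReal.ofReal_mul (by have := Real.pi_pos; positivity)]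
    apply ENNReal.ofReal_le_ofReal
    apply le_of_eq
    have e : Real.exp (-(c * (m + 1 : ℕ))) * (Real.exp (c * (m + 1 : ℕ)) - Real.exp (c * m)) =
        1 - Real.exp (-c) := by
      rw [mul_sub, ← Real.exp_add, ← Real.exp_add, neg_add_cancel, Real.exp_zero]
      congr 2; push_cast; ring
    rw [hQ, ← e]; ring
  have hsum : ENNReal.ofReal (∑ m ∈ S, Q * Real.exp (-(p * C2)) * G * x m) ≤
      ENNReal.ofReal (Real.exp (C + 2 * τ n - p * wt α (τ n))) := by
    rw [ENNReal.ofReal_sum_of_nonneg (fun m _ => by positivity)]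
    refine le_trans (Finset.sum_le_sum fun m _ => hone m) ?_
    rw [← lintegral_biUnion_finset (fun i _ j _ hij => hdisj hij)
      (fun m _ => measurableSet_Ico)]
    refine le_trans (lintegral_mono_set ?_) (h3 n)
    intro r hr
    simp only [Set.mem_iUnion] at hr
    obtain ⟨m, _, hr⟩ := hr
    exact (Real.exp_pos _).trans_le hr.1
  rw [ENNReal.ofReal_le_ofReal_iff (Real.exp_pos _).le, ← Finset.mul_sum,
    show C + 2 * τ n - p * wt α (τ n) = C + (2 * τ n - p * wt α (τ n)) by ring, Real.exp_add,
    ← hG] at hsum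
  have hG0 : 0 < G := Real.exp_pos _
  rw [le_div_iff₀ hQ0, Real.exp_add]
  have h4 : (∑ m ∈ S, x m) * Q * Real.exp (-(p * C2)) ≤ Real.exp C :=
    le_of_mul_le_mul_right (by linarith) hG0
  rw [Real.exp_neg, ← div_eq_mul_inv, div_le_iff₀ (Real.exp_pos _)] at h4
  exact h4

lemma nec_gap {p c E : ℝ} (hp : 0 < p) {D : ℕ → ℝ}
    (h : ∀ (n : ℕ) (S : Finset ℕ), ∑ m ∈ S, Real.exp (p * (D m - D n -
      max (((m : ℝ) - n) * c) 0)) ≤ E) (hc : 0 < c) (K : ℝ) :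
    ∃ N : ℕ, 1 ≤ N ∧ ∀ n, K ≤ D (n + N) - D n ∧ D (n + N) - D n ≤ N * c - K := by
  have hE : 0 ≤ E := by simpa using h 0 ∅
  have up : ∀ n j : ℕ, Real.exp (p * (D (n + j) - D n - j * c)) ≤ E := by
    intro n j
    have := h n {n + j}
    rw [Finset.sum_singleton, max_eq_left (by push_cast; rw [add_sub_cancel_left]; positivity)]
      at this
    push_cast at this
    rwa [add_sub_cancel_left] at this
  have dn : ∀ n j : ℕ, Real.exp (p * (D n - D (n + j))) ≤ E := by
    intro n j
    have := h (n + j) {n}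
    rw [Finset.sum_singleton, max_eq_right (by
      push_cast
      have : (0 : ℝ) ≤ j * c := by positivity
      linarith), sub_zero] at this
    exact this
  obtain ⟨N, hN⟩ := exists_nat_ge (E * E * Real.exp (p * K))
  have fin : ∀ y : ℝ, ((N : ℝ) + 1) * Real.exp (p * y) ≤ E * E → y ≤ -K := by
    intro y hy
    by_contra! h1
    have h2 : Real.exp (p * -K) ≤ Real.exp (p * y) :=
      Real.exp_le_exp.2 (mul_le_mul_of_nonneg_left h1.le hp.le)
    have h3 : Real.exp (p * K) * Real.exp (p * -K) = 1 := by
      rw [← Real.exp_add]; simp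
    have h4 : 0 < Real.exp (p * -K) := Real.exp_pos _
    have h5 := mul_le_mul_of_nonneg_right hN h4.le
    rw [mul_assoc, h3] at h5
    nlinarith
  have hN1 : 1 ≤ N + 1 := by omega
  obtain ⟨N', hN'⟩ : ∃ N', N' = N + 1 := ⟨_, rfl⟩
  refine ⟨N', by omega, fun n => ⟨?_, ?_⟩⟩
  · have h1 := h (n + N') ((Finset.range (N' + 1)).image (fun j => n + j))
    rw [Finset.sum_image (by intro a _ b _ hab; simpa using hab)] at h1
    have h2 : ∀ j ∈ Finset.range (N' + 1), Real.exp (p * (D n - D (n + N'))) ≤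
        E * Real.exp (p * (D (n + j) - D (n + N') -
          max ((((n + j : ℕ) : ℝ) - (n + N' : ℕ)) * c) 0)) := by
      intro j hj
      have hj' : (j : ℝ) ≤ N' := by
        exact_mod_cast Nat.lt_succ_iff.1 (Finset.mem_range.1 hj)
      rw [max_eq_right (by push_cast; nlinarith), sub_zero]
      refine le_trans (le_of_eq ?_) (mul_le_mul_of_nonneg_right (dn n j) (Real.exp_pos _).le)
      rw [← Real.exp_add]; congr 1; ring
    have h3 := Finset.sum_le_sum h2
    rw [← Finset.mul_sum, Finset.sum_const, Finset.card_range, nsmul_eq_mul] at h3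
    have h4 := h3.trans (mul_le_mul_of_nonneg_left h1 hE)
    have h5 := fin (D n - D (n + N')) (le_trans (mul_le_mul_of_nonneg_right
      (by rw [hN']; push_cast; linarith) (Real.exp_pos _).le) h4)
    linarith
  · have h1 := h n ((Finset.range (N' + 1)).image (fun j => n + j))
    rw [Finset.sum_image (by intro a _ b _ hab; simpa using hab)] at h1
    have h2 : ∀ j ∈ Finset.range (N' + 1), Real.exp (p * (D (n + N') - D n - N' * c)) ≤
        E * Real.exp (p * (D (n + j) - D n -
          max ((((n + j : ℕ) : ℝ) - n) * c) 0)) := by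
      intro j hj
      obtain ⟨i, rfl⟩ := Nat.exists_eq_add_of_le (Nat.lt_succ_iff.1 (Finset.mem_range.1 hj))
      rw [max_eq_left (by push_cast; rw [add_sub_cancel_left]; positivity)]
      refine le_trans (le_of_eq ?_) (mul_le_mul_of_nonneg_right (up (n + j) i) (Real.exp_pos _).le)
      rw [← Real.exp_add, add_assoc]; congr 1; push_cast; ring
    have h3 := Finset.sum_le_sum h2
    rw [← Finset.mul_sum, Finset.sum_const, Finset.card_range, nsmul_eq_mul] at h3
    have h4 := h3.trans (mul_le_mul_of_nonneg_left h1 hE)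
    have h5 := fin (D (n + N') - D n - N' * c) (le_trans (mul_le_mul_of_nonneg_right
      (by rw [hN']; push_cast; linarith) (Real.exp_pos _).le) h4)
    linarith

lemma core_of_gap {α M ε0 : ℝ} (hα : 0 < α) {D : ℕ → ℝ} (hM : ∀ k, |D (k + 1) - D k| ≤ M)
    {N : ℕ} (hN : 1 ≤ N) (hε : 0 < ε0)
    (h : ∀ n, ε0 ≤ D (n + N) - D n ∧ D (n + N) - D n ≤ N * (1 / (2 * α)) - ε0) :
    CoreC α D := by
  set c := 1 / (2 * α) with hc
  have hc0 : 0 < c := by positivity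
  have hM0 : 0 ≤ M := (abs_nonneg _).trans (hM 0)
  have hN0 : (0 : ℝ) < N := by exact_mod_cast hN
  have rem : ∀ r n : ℕ, |D (n + r) - D n| ≤ r * M := by
    intro r
    induction r with
    | zero => intro n; simp
    | succ r ih =>
      intro n
      have h1 := abs_le.1 (ih n)
      have h2 := abs_le.1 (hM (n + r))
      rw [abs_le, ← add_assoc]
      push_cast
      constructor <;> linarith [h1.1, h1.2, h2.1, h2.2]
  have quo : ∀ k n : ℕ, k * ε0 ≤ D (n + N * k) - D n ∧
      D (n + N * k) - D n ≤ k * (N * c - ε0) := by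
    intro k
    induction k with
    | zero => intro n; simp
    | succ k ih =>
      intro n
      have h1 := ih n
      have h2 := h (n + N * k)
      rw [show n + N * (k + 1) = n + N * k + N by ring]
      push_cast
      constructor <;> linarith [h1.1, h1.2, h2.1, h2.2]
  refine ⟨ε0 / N, ε0 + N * M, by positivity, fun n j => ?_⟩
  have hj := Nat.div_add_mod j N
  have hr := Nat.mod_lt j (show 0 < N by omega)
  generalize j / N = k at *
  generalize j % N = r at *
  subst hj
  have hr' : (r : ℝ) ≤ N := by exact_mod_cast hr.le
  have h1 := quo k n
  have h2 := abs_le.1 (rem r (n + N * k))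
  rw [add_assoc] at h2
  have h3 : (r : ℝ) * M ≤ N * M := mul_le_mul_of_nonneg_right hr' hM0
  have h4 : ε0 / N * ((N * k + r : ℕ) : ℝ) = k * ε0 + ε0 * (r / N) := by
    push_cast; field_simp
  have h5 : (c - ε0 / N) * ((N * k + r : ℕ) : ℝ) = k * (N * c - ε0) + r * c - ε0 * (r / N) := by
    push_cast; field_simp; ring
  have h6 : ε0 * (r / N) ≤ ε0 := mul_le_of_le_one_right hε.le ((div_le_one hN0).2 hr')
  have h7 : 0 ≤ ε0 * (r / N) := by positivity
  have h8 : 0 ≤ (r : ℝ) * c := by positivity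
  rw [h4, h5]
  constructor <;> linarith [h1.1, h1.2, h2.1, h2.2]

lemma Df_inc {α p q : ℝ} (hα : 0 < α) (hp : 1 ≤ p) (hq : 1 / p + 1 / q = 1) {δ τ : ℕ → ℝ}
    (hτ : ∀ k, τ k = ((k : ℝ) + 2) / (2 * α) + δ (k + 1)) (n N : ℕ) :
    Df α p τ (n + N) - Df α p τ n = N * (1 / (4 * α) - 1 / (q * α)) -
      ∑ k ∈ Finset.range N, δ (n + 1 + k) := by
  induction N with
  | zero => simp
  | succ N ih =>
    have h1 : Df α p τ (n + (N + 1)) = Df α p τ (n + N) + (1 / (4 * α) + 1 / (p * α) -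
        (τ (n + N) - 1 / (2 * α) * (n + N : ℕ))) := by
      unfold Df; rw [← add_assoc, Finset.sum_range_succ]
    rw [h1, Finset.sum_range_succ, hτ, show n + N + 1 = n + 1 + N by ring]
    have h2 : 1 / (p * α) = (1 - 1 / q) * (1 / α) := by
      rw [show 1 - 1 / q = 1 / p by linarith, one_div, mul_inv, one_div, one_div]
    have h3 : 1 / (q * α) = (1 / q) * (1 / α) := by
      rw [one_div, mul_inv, one_div, one_div]
    rw [h3] at ih ⊢
    rw [h2]
    have h4 : ((n + N : ℕ) + 2 : ℝ) / (2 * α) = 1 / (2 * α) * (n + N : ℕ) + 1 / α := by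
      field_simp
    rw [h4]
    push_cast
    linear_combination ih

lemma fin_pos (F : Finset ℕ) (f : ℕ → ℝ) (hf : ∀ n, 0 < f n) : ∃ ε, 0 < ε ∧ ∀ n ∈ F, ε ≤ f n := by
  rcases F.eq_empty_or_nonempty with rfl | h
  · exact ⟨1, one_pos, by simp⟩
  · obtain ⟨m, _, h2⟩ := F.exists_min_image f h
    exact ⟨f m, hf m, h2⟩

lemma sep_forward {α κ : ℝ} (hα : 0 < α) (hκ : 0 < κ) {γ : ℕ → ℂ} (hinj : Function.Injective γ)
    (hpos : ∀ n, 0 < ‖γ n‖) (hmono : ∀ n, 1 ≤ n → ‖γ 1‖ ≤ ‖γ n‖)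
    (hfin : ∀ T, {n : ℕ | ‖γ n‖ ≤ T}.Finite)
    (h : ∀ m n, m ≠ n → 1 ≤ m → 1 ≤ n → κ * ‖γ n‖ ≤ ‖γ m - γ n‖) :
    DRhoSeparated α (Set.range γ) := by
  obtain ⟨κ1, hκ1, h1⟩ := fin_pos (hfin (2 * ‖γ 0‖)).toFinset
    (fun n => if n = 0 then 1 else ‖γ 0 - γ n‖ / ‖γ n‖) (fun n => by
      split_ifs with h0
      · exact one_pos
      · exact div_pos (norm_pos_iff.2 (sub_ne_zero.2 fun e => h0 (hinj e.symm))) (hpos n))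
  have h0 : ∀ n, 1 ≤ n → min κ1 (1 / 2) * ‖γ n‖ ≤ ‖γ 0 - γ n‖ := by
    intro n hn
    by_cases hn2 : ‖γ n‖ ≤ 2 * ‖γ 0‖
    · have := h1 n (by simpa using hn2)
      rw [if_neg (by omega), le_div_iff₀ (hpos n)] at this
      exact le_trans (mul_le_mul_of_nonneg_right (min_le_left _ _) (hpos n).le) this
    · push Not at hn2
      have h2 := norm_sub_norm_le (γ n) (γ 0)
      rw [norm_sub_rev] at h2
      have := mul_le_mul_of_nonneg_right (min_le_right κ1 (1 / 2)) (hpos n).le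
      linarith
  set κ2 := min κ (min κ1 (1 / 2)) with hκ2
  have hkappos : 0 < κ2 := lt_min hκ (lt_min hκ1 (by norm_num))
  have hall : ∀ m n, m ≠ n → 1 ≤ n → κ2 * ‖γ n‖ ≤ ‖γ m - γ n‖ := by
    intro m n hmn hn
    rcases Nat.eq_zero_or_pos m with rfl | hm
    · exact le_trans (mul_le_mul_of_nonneg_right (min_le_right _ _) (hpos n).le) (h0 n hn)
    · exact le_trans (mul_le_mul_of_nonneg_right (min_le_left _ _) (hpos n).le) (h m n hmn hm hn)
  set s := Real.sqrt (2 * α) with hs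
  have hs0 : 0 < s := Real.sqrt_pos.2 (by positivity)
  have hb := hpos 1
  have hρ : ∀ z : ℂ, 0 ≤ rhoF α z := fun z => by unfold rhoF; positivity
  have hfinal : ∀ m n, m ≠ n → 1 ≤ n → κ2 / (1 / ‖γ 1‖ + 1 / s) ≤ dRho α (γ m) (γ n) := by
    intro m n hmn hn
    unfold dRho
    have h3 : 0 < 1 + min (rhoF α (γ m)) (rhoF α (γ n)) := by
      have := le_min (hρ (γ m)) (hρ (γ n)); linarith
    rw [div_le_div_iff₀ (by positivity) h3]
    have h4 : 1 + min (rhoF α (γ m)) (rhoF α (γ n)) ≤ ‖γ n‖ * (1 / ‖γ 1‖ + 1 / s) := by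
      have h5 : min (rhoF α (γ m)) (rhoF α (γ n)) ≤ ‖γ n‖ / s := min_le_right _ _
      have h6 : 1 ≤ ‖γ n‖ / ‖γ 1‖ := (one_le_div hb).2 (hmono n hn)
      rw [mul_add, mul_one_div, mul_one_div]; linarith
    calc _ ≤ κ2 * (‖γ n‖ * (1 / ‖γ 1‖ + 1 / s)) := mul_le_mul_of_nonneg_left h4 hkappos.le
      _ = (κ2 * ‖γ n‖) * (1 / ‖γ 1‖ + 1 / s) := by ring
      _ ≤ _ := mul_le_mul_of_nonneg_right (hall m n hmn hn) (by positivity)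
  refine ⟨κ2 / (1 / ‖γ 1‖ + 1 / s), by positivity, ?_⟩
  rintro _ ⟨m, rfl⟩ _ ⟨n, rfl⟩ hne
  have hmn : m ≠ n := fun e => hne (by rw [e])
  rcases Nat.eq_zero_or_pos n with rfl | hn
  · have := hfinal 0 m hmn.symm (by omega)
    unfold dRho at *
    rwa [norm_sub_rev, min_comm]
  · exact hfinal m n hmn hn

lemma sep_backward {α ε : ℝ} (hα : 0 < α) (hε : 0 < ε) {z w : ℂ} (h : ε ≤ dRho α z w) :
    ε / Real.sqrt (2 * α) * min ‖z‖ ‖w‖ ≤ ‖z - w‖ := by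
  have hs0 : 0 < Real.sqrt (2 * α) := Real.sqrt_pos.2 (by positivity)
  have e : min (rhoF α z) (rhoF α w) = min ‖z‖ ‖w‖ / Real.sqrt (2 * α) := by
    unfold rhoF
    exact (min_div_div_right hs0.le _ _)
  unfold dRho at h
  rw [e] at h
  have h0 : 0 ≤ min ‖z‖ ‖w‖ / Real.sqrt (2 * α) :=
    div_nonneg (le_min (norm_nonneg _) (norm_nonneg _)) hs0.le
  rw [le_div_iff₀ (by linarith)] at h
  calc _ = ε * (min ‖z‖ ‖w‖ / Real.sqrt (2 * α)) := by ring
    _ ≤ _ := by nlinarith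

lemma statement_aux (α p q : ℝ) (hα : 0 < α) (hp : 1 ≤ p)
    (hq : 1 / p + 1 / q = 1)
    (γ : ℕ → ℂ) (hinj : Function.Injective γ)
    (hmono : ∀ n, ‖γ n‖ ≤ ‖γ (n + 1)‖)
    (δ : ℕ → ℝ)
    (hnorm : ∀ n, ‖γ n‖ = Real.exp ((1 + (n : ℝ)) / (2 * α) + δ n)) :
    CompleteInterpolating α p (Set.range fun k => γ (k + 1)) ↔
      (DRhoSeparated α (Set.range γ) ∧
       (∃ M : ℝ, ∀ n, |δ n| ≤ M) ∧
       (∃ N : ℕ, 1 ≤ N ∧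
         -(1 / (4 * α) + 1 / (q * α)) < (⨅ n : ℕ, avgD δ N n) ∧
         (⨆ n : ℕ, avgD δ N n) < 1 / (4 * α) - 1 / (q * α))) := by
  have hp0 : 0 < p := by linarith
  set c := 1 / (2 * α) with hc
  have hc0 : 0 < c := by positivity
  set A := 1 / (4 * α) - 1 / (q * α) with hA
  have hA2 : -(1 / (4 * α) + 1 / (q * α)) = A - c := by
    rw [hA, hc]; field_simp; ring
  rw [hA2]
  obtain ⟨τ, hτ⟩ : ∃ τ : ℕ → ℝ, ∀ k, τ k = ((k : ℝ) + 2) / (2 * α) + δ (k + 1) :=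
    ⟨_, fun _ => rfl⟩
  have hgτ : ∀ k, ‖γ (k + 1)‖ = Real.exp (τ k) := by
    intro k
    rw [hnorm, hτ]; congr 2; push_cast; ring
  have hg : Function.Injective fun k => γ (k + 1) := fun a b h => by
    have := hinj h; omega
  have hτδ : ∀ k, τ k - 1 / (2 * α) * k = 1 / α + δ (k + 1) := by
    intro k; rw [hτ]; field_simp; ring
  have hτm : Monotone τ := monotone_nat_of_le_succ fun n => by
    have := hmono (n + 1)
    rw [hgτ, hgτ] at this
    exact Real.exp_le_exp.1 this
  have hpos : ∀ n, 0 < ‖γ n‖ := fun n => by rw [hnorm]; exact Real.exp_pos _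
  have hD := Df_inc hα hp hq hτ
  have havg : ∀ N n : ℕ, 1 ≤ N → ∑ k ∈ Finset.range N, δ (n + k) = N * avgD δ N n := by
    intro N n hN
    unfold avgD
    have : (N : ℝ) ≠ 0 := by positivity
    field_simp
  constructor
  · intro hCI
    obtain ⟨C, κ, a, hκ, hsep, ha, hb, hi⟩ := nec_pack hα hp hg hgτ hτm hCI
    have hfin := nec_tau hα hp hg hgτ hCI.1
    obtain ⟨B, hB⟩ := nec_bdd hα hp hτm hfin (nec_bdd' ha hb)
    have hM : ∃ M : ℝ, ∀ n, |δ n| ≤ M := by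
      refine ⟨max |δ 0| (B + 1 / α), fun n => ?_⟩
      rcases n with _ | n
      · exact le_max_left _ _
      · refine le_trans ?_ (le_max_right _ _)
        have h1 := hB n
        rw [hτδ] at h1
        have h2 : 0 < 1 / α := by positivity
        rw [abs_le] at *
        constructor <;> linarith [h1.1, h1.2]
    refine ⟨?_, hM, ?_⟩
    · refine sep_forward hα hκ hinj hpos ?_ ?_ ?_
      · intro n hn
        exact monotone_nat_of_le_succ hmono hn
      · intro T
        by_cases hT : 0 < T
        · have h1 := ((hfin (Real.log T)).image (fun n => n + 1)).union (Set.finite_singleton 0)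
          refine h1.subset fun n hn => ?_
          rcases n with _ | n
          · right; rfl
          · left
            refine ⟨n, ?_, rfl⟩
            simp only [Set.mem_ofPred_eq] at hn ⊢
            rw [hgτ] at hn
            exact (Real.le_log_iff_exp_le hT).2 hn
        · refine Set.finite_empty.subset fun n hn => ?_
          simp only [Set.mem_ofPred_eq] at hn
          exact hT ((hpos n).trans_le hn)
      · intro m n hmn hm hn
        obtain ⟨m, rfl⟩ := Nat.exists_eq_add_of_le' hm
        obtain ⟨n, rfl⟩ := Nat.exists_eq_add_of_le' hn
        exact hsep m n (by omega)
    · obtain ⟨M, hM⟩ := hM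
      obtain ⟨E, hE⟩ := nec_sum hα hp hB ha hi
      obtain ⟨N, hN, hgap⟩ := nec_gap hp0 hE hc0 (2 * M + 1)
      have hM0 : 0 ≤ M := (abs_nonneg _).trans (hM 0)
      have hN0 : (0 : ℝ) < N := by exact_mod_cast hN
      have hbound : ∀ n, A - c + 1 / N ≤ avgD δ N n ∧ avgD δ N n ≤ A - 1 / N := by
        intro n
        have hw : 1 ≤ N * A - N * avgD δ N n ∧ N * A - N * avgD δ N n ≤ N * c - 1 := by
          rcases n with _ | n
          · have h1 := hgap 0
            rw [hD] at h1
            have h2 : ∑ k ∈ Finset.range N, δ (0 + 1 + k) + δ 0 =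
                ∑ k ∈ Finset.range N, δ (0 + k) + δ N := by
              have e1 := Finset.sum_range_succ δ N
              have e2 := Finset.sum_range_succ' δ N
              simp only [zero_add]
              rw [← e1, e2]
              simp only [add_comm 1]
            rw [havg N 0 hN] at h2
            have h3 := abs_le.1 (hM 0)
            have h4 := abs_le.1 (hM N)
            constructor <;> linarith [h1.1, h1.2, h3.1, h3.2, h4.1, h4.2]
          · have h1 := hgap n
            rw [hD, havg N (n + 1) hN] at h1
            constructor <;> linarith [h1.1, h1.2]
        have e1 : (N : ℝ) * (1 / N) = 1 := by field_simp
        constructor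
        · apply le_of_mul_le_mul_left _ hN0
          linarith [hw.1, hw.2]
        · apply le_of_mul_le_mul_left _ hN0
          linarith [hw.1, hw.2]
      have hN1 : (0 : ℝ) < 1 / N := by positivity
      refine ⟨N, hN, ?_, ?_⟩
      · have := le_ciInf fun n => (hbound n).1
        linarith
      · have := ciSup_le fun n => (hbound n).2
        linarith
  · rintro ⟨⟨ε, hε, hsep⟩, ⟨M, hM⟩, N, hN, hlo, hhi⟩
    have hM0 : 0 ≤ M := (abs_nonneg _).trans (hM 0)
    have hN0 : (0 : ℝ) < N := by exact_mod_cast hN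
    have havb : ∀ n, |avgD δ N n| ≤ M := by
      intro n
      have h1 : |∑ k ∈ Finset.range N, δ (n + k)| ≤ N * M := by
        refine (Finset.abs_sum_le_sum_abs _ _).trans ?_
        refine (Finset.sum_le_sum fun k _ => hM (n + k)).trans ?_
        simp
      rw [havg N n hN, abs_mul, abs_of_pos hN0] at h1
      exact le_of_mul_le_mul_left h1 hN0
    have b1 : BddBelow (Set.range fun n => avgD δ N n) :=
      ⟨-M, by rintro _ ⟨n, rfl⟩; exact (abs_le.1 (havb n)).1⟩
    have b2 : BddAbove (Set.range fun n => avgD δ N n) :=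
      ⟨M, by rintro _ ⟨n, rfl⟩; exact (abs_le.1 (havb n)).2⟩
    have s0 : 0 < ε / Real.sqrt (2 * α) := div_pos hε (Real.sqrt_pos.2 (by positivity))
    refine suff hα hp s0 hg hgτ (B := M + 1 / α) (fun k => ?_) (fun m n hmn => ?_) ?_
    · rw [hτδ]
      have h2 : 0 < 1 / α := by positivity
      have h3 := abs_le.1 (hM (k + 1))
      rw [abs_le]
      constructor <;> linarith [h3.1, h3.2]
    · exact sep_backward hα hε (hsep _ ⟨_, rfl⟩ _ ⟨_, rfl⟩ fun e => hmn (hg e))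
    · have hpos2 : 0 < N * min (A - ⨆ n : ℕ, avgD δ N n) ((⨅ n : ℕ, avgD δ N n) - (A - c)) :=
        mul_pos hN0 (lt_min (by linarith) (by linarith))
      refine core_of_gap (M := |A| + M) hα (fun k => ?_) hN hpos2 (fun n => ?_)
      · rw [hD k 1]
        simp only [Nat.cast_one, one_mul, Finset.range_one, Finset.sum_singleton]
        exact (abs_sub _ _).trans (by linarith [hM (k + 1 + 0)])
      · rw [hD, havg N (n + 1) hN, ← mul_sub, ← mul_sub]
        have h1 := ciInf_le b1 (n + 1)
        have h2 := le_ciSup b2 (n + 1)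
        have h3 := min_le_left (A - ⨆ n : ℕ, avgD δ N n) ((⨅ n : ℕ, avgD δ N n) - (A - c))
        have h4 := min_le_right (A - ⨆ n : ℕ, avgD δ N n) ((⨅ n : ℕ, avgD δ N n) - (A - c))
        constructor
        · apply mul_le_mul_of_nonneg_left _ hN0.le
          linarith
        · apply mul_le_mul_of_nonneg_left _ hN0.le
          linarith

/-- Kadets–Ingham type theorem for `F^p_φ`, `1 ≤ p < 4/3`:
`Γ ∖ {γ₀}` is a complete interpolating sequence iff `Γ` is `d_ρ`-separated, `(δ_n)` is
bounded, and `-(1/(4α) + 1/(qα)) < ∇_N ≤ Δ_N < 1/(4α) - 1/(qα)` for some `N ≥ 1`. -/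
theorem statement0 (α p q : ℝ) (hα : 0 < α) (hp : 1 ≤ p) (hp' : p < 4 / 3)
    (hq : 1 / p + 1 / q = 1)
    (γ : ℕ → ℂ) (hinj : Function.Injective γ)
    (hmono : ∀ n, ‖γ n‖ ≤ ‖γ (n + 1)‖)
    (δ θ : ℕ → ℝ)
    (hdecomp : ∀ n, γ n =
      (Real.exp ((1 + (n : ℝ)) / (2 * α) + δ n) : ℂ) * Complex.exp ((θ n : ℂ) * Complex.I)) :
    CompleteInterpolating α p {z : ℂ | ∃ n : ℕ, 1 ≤ n ∧ γ n = z} ↔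
      (DRhoSeparated α (Set.range γ) ∧
       (∃ M : ℝ, ∀ n, |δ n| ≤ M) ∧
       (∃ N : ℕ, 1 ≤ N ∧
         -(1 / (4 * α) + 1 / (q * α)) < (⨅ n : ℕ, avgD δ N n) ∧
         (⨆ n : ℕ, avgD δ N n) < 1 / (4 * α) - 1 / (q * α))) := by
  have hset : {z : ℂ | ∃ n : ℕ, 1 ≤ n ∧ γ n = z} = Set.range fun k => γ (k + 1) := by
    ext z
    constructor
    · rintro ⟨n, hn, rfl⟩
      obtain ⟨m, rfl⟩ := Nat.exists_eq_add_of_le' hn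
      exact ⟨m, rfl⟩
    · rintro ⟨m, rfl⟩
      exact ⟨m + 1, by omega, rfl⟩
  rw [hset]
  refine statement_aux α p q hα hp hq γ hinj hmono δ fun n => ?_
  rw [hdecomp n, norm_mul, Complex.norm_exp_ofReal_mul_I, mul_one, Complex.norm_real,
    Real.norm_of_nonneg (Real.exp_pos _).le]

end
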